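/- If two convex polyhedra in \mathbb{R}^{2,1} (with non-null unit outward face normals) have the same set of pairs (outward unit normal, face area), then they are translates of one another. -/

import Mathlib

open MeasureTheory

noncomputable section

/-- The Minkowski bilinear form on `ℝ^{2,1}` (signature `(+,-,-)`). -/
def mink (x y : EuclideanSpace ℝ (Fin 3)) : ℝ := x 0 * y 0 - x 1 * y 1 - x 2 * y 2

/-- The face of `P` with outward (Minkowski) normal `v`. -/
def mface (P : Set (EuclideanSpace ℝ (Fin 3))) (v : EuclideanSpace ℝ (Fin 3)) :
    Set (EuclideanSpace ℝ (Fin 3)) :=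
  {x ∈ P | ∀ y ∈ P, mink y v ≤ mink x v}

/-- Minkowskian face area for a face with `mink`-unit normal `v` (Hausdorff area with the
Euclidean-to-Minkowskian correction factor `1/‖v‖`). -/
def minkArea (S : Set (EuclideanSpace ℝ (Fin 3))) (v : EuclideanSpace ℝ (Fin 3)) : ℝ :=
  (μH[2] S).toReal / ‖v‖

open Set Filter Topology in
lemma aux_bm1_compact (A B C : Set ℝ) (hA : IsCompact A) (hB : IsCompact B)
    (hAn : A.Nonempty) (hBn : B.Nonempty) (hC : ∀ x ∈ A, ∀ y ∈ B, x + y ∈ C) :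
    volume A + volume B ≤ volume C := by
  obtain ⟨a, haA, ha⟩ := hA.exists_isGreatest hAn
  obtain ⟨b, hbB, hb⟩ := hB.exists_isLeast hBn
  have h1 : volume ((fun x => x + b) '' A) = volume A := by
    simp
  have h2 : volume ((fun x => x + a) '' B) = volume B := by
    simp
  have hmB : MeasurableSet ((fun x => x + a) '' B) :=
    (hB.image (by fun_prop)).measurableSet
  rw [← h1, ← h2]
  have hd : AEDisjoint volume ((fun x => x + b) '' A) ((fun x => x + a) '' B) := by
    have : ((fun x => x + b) '' A) ∩ ((fun x => x + a) '' B) ⊆ {a + b} := by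
      rintro z ⟨⟨x, hx, rfl⟩, ⟨y, hy, hxy⟩⟩
      have := ha hx
      have := hb hy
      simp only [mem_singleton_iff] at *
      linarith
    exact measure_mono_null this (by simp)
  rw [← measure_union₀ hmB.nullMeasurableSet hd]
  apply measure_mono
  rintro z (⟨x, hx, rfl⟩ | ⟨x, hx, rfl⟩)
  · exact hC x hx b hbB
  · show x + a ∈ C
    rw [add_comm]; exact hC a haA x hx

open Set in
lemma aux_bm1_add (A B C : Set ℝ) (hA : MeasurableSet A) (hB : MeasurableSet B)
    (hAn : A.Nonempty) (hBn : B.Nonempty) (hC : ∀ x ∈ A, ∀ y ∈ B, x + y ∈ C) :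
    volume A + volume B ≤ volume C := by
  obtain ⟨a, ha⟩ := hAn
  obtain ⟨b, hb⟩ := hBn
  have e : ∀ S : Set ℝ, MeasurableSet S →
      volume S = ⨆ (K : Set ℝ) (_ : K ⊆ S ∧ IsCompact K), volume K := by
    intro S hS
    rw [hS.measure_eq_iSup_isCompact]
    simp only [iSup_and]
  rw [e A hA, e B hB]
  refine ENNReal.biSup_add_biSup_le' ⟨∅, empty_subset _, isCompact_empty⟩
    ⟨∅, empty_subset _, isCompact_empty⟩ ?_
  rintro K ⟨hKA, hK⟩ L ⟨hLB, hL⟩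
  refine le_trans (add_le_add (measure_mono (subset_insert a K)) (measure_mono (subset_insert b L)))
    (aux_bm1_compact _ _ C (hK.insert a) (hL.insert b) (insert_nonempty _ _) (insert_nonempty _ _) ?_)
  intro x hx y hy
  exact hC x (insert_subset ha hKA hx) y (insert_subset hb hLB hy)

lemma aux_amgm (l : ℝ) (h0 : 0 < l) (h1 : l < 1) (x y : ENNReal) :
    x ^ (1 - l) * y ^ l ≤ ENNReal.ofReal (1 - l) * x + ENNReal.ofReal l * y := by
  by_cases hx : x = ⊤
  · subst hx
    rw [ENNReal.mul_top (by simpa using h1)]; simp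
  by_cases hy : y = ⊤
  · subst hy
    rw [ENNReal.mul_top (a := ENNReal.ofReal l) (by simpa using h0)]; simp
  lift x to NNReal using hx
  lift y to NNReal using hy
  have := NNReal.geom_mean_le_arith_mean2_weighted ⟨1 - l, by linarith⟩ ⟨l, h0.le⟩ x y
    (by ext; show (1 - l) + l = 1; ring)
  rw [ENNReal.ofReal, ENNReal.ofReal, ← ENNReal.coe_rpow_of_nonneg _ (by linarith),
    ← ENNReal.coe_rpow_of_nonneg _ h0.le, Real.toNNReal_of_nonneg h0.le,
    Real.toNNReal_of_nonneg (by linarith : 0 ≤ 1 - l)]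
  exact_mod_cast this

open Set Pointwise in
lemma aux_bm1 (l : ℝ) (h0 : 0 < l) (h1 : l < 1) (A B C : Set ℝ) (hA : MeasurableSet A)
    (hB : MeasurableSet B)
    (hAn : A.Nonempty) (hBn : B.Nonempty) (hC : ∀ x ∈ A, ∀ y ∈ B, (1 - l) * x + l * y ∈ C) :
    ENNReal.ofReal (1 - l) * volume A + ENNReal.ofReal l * volume B ≤ volume C := by
  have := aux_bm1_add ((1 - l) • A) (l • B) C (hA.const_smul₀ _) (hB.const_smul₀ _)
    hAn.smul_set hBn.smul_set ?_
  · rw [Measure.addHaar_smul_of_nonneg _ (by linarith), Measure.addHaar_smul_of_nonneg _ h0.le]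
      at this
    simpa using this
  · rintro _ ⟨x, hx, rfl⟩ _ ⟨y, hy, rfl⟩
    exact hC x hx y hy

open Set in
lemma aux_pl_norm (l : ℝ) (h0 : 0 < l) (h1 : l < 1) (f g h : ℝ → ℝ)
    (hf : Measurable f) (hg : Measurable g) (hh : Measurable h)
    (f0 : ∀ x, 0 ≤ f x) (g0 : ∀ x, 0 ≤ g x) (hh0 : ∀ x, 0 ≤ h x)
    (f1 : ∀ x, f x ≤ 1) (g1 : ∀ x, g x ≤ 1)
    (fs : ∀ r < 1, ∃ x, r < f x) (gs : ∀ r < 1, ∃ x, r < g x)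
    (H : ∀ x y, f x ^ (1 - l) * g y ^ l ≤ h ((1 - l) * x + l * y)) :
    ENNReal.ofReal (1 - l) * (∫⁻ x, ENNReal.ofReal (f x)) +
      ENNReal.ofReal l * (∫⁻ x, ENNReal.ofReal (g x)) ≤ ∫⁻ x, ENNReal.ofReal (h x) := by
  rw [lintegral_eq_lintegral_meas_lt _ (ae_of_all _ f0) hf.aemeasurable,
    lintegral_eq_lintegral_meas_lt _ (ae_of_all _ g0) hg.aemeasurable,
    lintegral_eq_lintegral_meas_lt _ (ae_of_all _ hh0) hh.aemeasurable]
  rw [← lintegral_const_mul' _ _ (by simp), ← lintegral_const_mul' _ _ (by simp)]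
  have hmf : Measurable (fun t : ℝ => volume {a | t < f a}) :=
    Antitone.measurable (fun s t hst => measure_mono (fun a (ha : t < f a) => lt_of_le_of_lt hst ha))
  rw [← lintegral_add_left (hmf.const_mul _)]
  refine setLIntegral_mono' measurableSet_Ioi ?_
  intro t (ht : 0 < t)
  by_cases ht1 : t < 1
  · apply aux_bm1 l h0 h1 _ _ _ (measurableSet_lt measurable_const hf)
      (measurableSet_lt measurable_const hg) (fs t ht1) (gs t ht1)
    intro x (hx : t < f x) y (hy : t < g y)
    refine lt_of_lt_of_le ?_ (H x y)
    calc t = t ^ (1 - l) * t ^ l := by rw [← Real.rpow_add ht]; simp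
      _ < _ := by
        apply mul_lt_mul'' (Real.rpow_lt_rpow ht.le hx (by linarith))
          (Real.rpow_lt_rpow ht.le hy h0) <;> positivity
  · have e1 : {a | t < f a} = ∅ := by
      ext a; simp; linarith [f1 a]
    have e2 : {a | t < g a} = ∅ := by
      ext a; simp; linarith [g1 a]
    rw [e1, e2]; simp

open Set in
lemma aux_pl_bdd (l : ℝ) (h0 : 0 < l) (h1 : l < 1) (f g h : ℝ → ENNReal)
    (hf : Measurable f) (hg : Measurable g) (hh : Measurable h) (N : ENNReal) (hN : N ≠ ⊤)
    (f1 : ∀ x, f x ≤ N) (g1 : ∀ x, g x ≤ N)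
    (H : ∀ x y, f x ^ (1 - l) * g y ^ l ≤ h ((1 - l) * x + l * y)) :
    (∫⁻ x, f x) ^ (1 - l) * (∫⁻ x, g x) ^ l ≤ ∫⁻ x, h x := by
  have h1' : 0 < 1 - l := by linarith
  set a := ⨆ x, f x with ha
  set b := ⨆ x, g x with hb
  have hfa : ∀ x, f x ≤ a := le_iSup f
  have hgb : ∀ x, g x ≤ b := le_iSup g
  have haN : a ≠ ⊤ := ne_top_of_le_ne_top hN (iSup_le f1)
  have hbN : b ≠ ⊤ := ne_top_of_le_ne_top hN (iSup_le g1)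
  by_cases ha0 : a = 0
  · have : ∀ x, f x = 0 := fun x => le_antisymm (ha0 ▸ hfa x) zero_le
    simp [this, h1']
  by_cases hb0 : b = 0
  · have : ∀ x, g x = 0 := fun x => le_antisymm (hb0 ▸ hgb x) zero_le
    simp [this, h0]
  set c := a ^ (1 - l) * b ^ l with hc
  have hcN : c ≠ ⊤ := ENNReal.mul_ne_top (ENNReal.rpow_ne_top_of_nonneg h1'.le haN)
    (ENNReal.rpow_ne_top_of_nonneg h0.le hbN)
  have hc0 : c ≠ 0 := mul_ne_zero (by simp [ha0, haN]) (by simp [hb0, hbN])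
  have key := aux_pl_norm l h0 h1 (fun x => (f x / a).toReal) (fun x => (g x / b).toReal)
    (fun x => (min (h x) c / c).toReal) (by fun_prop) (by fun_prop) (by fun_prop)
    (fun x => ENNReal.toReal_nonneg) (fun x => ENNReal.toReal_nonneg)
    (fun x => ENNReal.toReal_nonneg)
    (fun x => ENNReal.toReal_le_of_le_ofReal zero_le_one (by simpa using ENNReal.div_le_of_le_mul (by simpa using hfa x)))
    (fun x => ENNReal.toReal_le_of_le_ofReal zero_le_one (by simpa using ENNReal.div_le_of_le_mul (by simpa using hgb x)))
    ?_ ?_ ?_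
  · have e1 : ∀ x, ENNReal.ofReal ((f x / a).toReal) = f x * a⁻¹ := fun x => by
      rw [ENNReal.ofReal_toReal (ENNReal.div_ne_top (ne_top_of_le_ne_top haN (hfa x)) ha0)]; rfl
    have e2 : ∀ x, ENNReal.ofReal ((g x / b).toReal) = g x * b⁻¹ := fun x => by
      rw [ENNReal.ofReal_toReal (ENNReal.div_ne_top (ne_top_of_le_ne_top hbN (hgb x)) hb0)]; rfl
    have e3 : ∀ x, ENNReal.ofReal ((min (h x) c / c).toReal) = min (h x) c * c⁻¹ := fun x => by
      rw [ENNReal.ofReal_toReal (ENNReal.div_ne_top (ne_top_of_le_ne_top hcN (min_le_right _ _)) hc0)]; rfl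
    simp only [e1, e2, e3] at key
    rw [lintegral_mul_const _ hf, lintegral_mul_const _ hg, lintegral_mul_const _ (by fun_prop)] at key
    have k2 := (aux_amgm l h0 h1 _ _).trans key
    rw [ENNReal.mul_rpow_of_nonneg _ _ h1'.le, ENNReal.mul_rpow_of_nonneg _ _ h0.le] at k2
    have e4 : (a⁻¹) ^ (1 - l) * (b⁻¹) ^ l = c⁻¹ := by
      rw [ENNReal.inv_rpow, ENNReal.inv_rpow, hc, ENNReal.mul_inv]
      · left; simp [ha0, haN]
      · left; exact ENNReal.rpow_ne_top_of_nonneg h1'.le haN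
    have e5 : (∫⁻ x, f x) ^ (1 - l) * (∫⁻ x, g x) ^ l * c⁻¹ ≤ (∫⁻ x, min (h x) c) * c⁻¹ := by
      rw [← e4] 
      rw [← e4] at k2
      refine le_trans (le_of_eq ?_) k2
      ring
    have e6 := (ENNReal.mul_le_mul_iff_left (ENNReal.inv_ne_zero.2 hcN) (ENNReal.inv_ne_top.2 hc0)).1 e5
    exact e6.trans (lintegral_mono fun x => min_le_left _ _)
  · intro r hr
    by_cases hr0 : r < 0
    · exact ⟨0, hr0.trans_le ENNReal.toReal_nonneg⟩
    push Not at hr0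
    have : ENNReal.ofReal r * a < a := by
      calc _ < 1 * a := by
            apply (ENNReal.mul_lt_mul_iff_left ha0 haN).2; simpa using hr
        _ = a := one_mul _
    obtain ⟨x, hx⟩ := lt_iSup_iff.1 this
    refine ⟨x, ?_⟩
    rw [← ENNReal.ofReal_lt_iff_lt_toReal hr0 (ENNReal.div_ne_top (ne_top_of_le_ne_top haN (hfa x)) ha0)]
    rwa [ENNReal.lt_div_iff_mul_lt (Or.inl ha0) (Or.inl haN)]
  · intro r hr
    by_cases hr0 : r < 0
    · exact ⟨0, hr0.trans_le ENNReal.toReal_nonneg⟩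
    push Not at hr0
    have : ENNReal.ofReal r * b < b := by
      calc _ < 1 * b := by
            apply (ENNReal.mul_lt_mul_iff_left hb0 hbN).2; simpa using hr
        _ = b := one_mul _
    obtain ⟨x, hx⟩ := lt_iSup_iff.1 this
    refine ⟨x, ?_⟩
    rw [← ENNReal.ofReal_lt_iff_lt_toReal hr0 (ENNReal.div_ne_top (ne_top_of_le_ne_top hbN (hgb x)) hb0)]
    rwa [ENNReal.lt_div_iff_mul_lt (Or.inl hb0) (Or.inl hbN)]
  · intro x y
    rw [ENNReal.toReal_rpow, ENNReal.toReal_rpow, ← ENNReal.toReal_mul]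
    apply ENNReal.toReal_mono (ENNReal.div_ne_top (ne_top_of_le_ne_top hcN (min_le_right _ _)) hc0)
    rw [ENNReal.div_rpow_of_nonneg _ _ h1'.le, ENNReal.div_rpow_of_nonneg _ _ h0.le]
    rw [ENNReal.div_eq_inv_mul, ENNReal.div_eq_inv_mul]
    have e4 : (a ^ (1 - l))⁻¹ * (b ^ l)⁻¹ = c⁻¹ := by
      rw [hc, ENNReal.mul_inv]
      · left; simp [ha0, haN]
      · left; exact ENNReal.rpow_ne_top_of_nonneg h1'.le haN
    calc _ = c⁻¹ * (f x ^ (1 - l) * g y ^ l) := by rw [← e4]; ring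
      _ ≤ c⁻¹ * min (h ((1 - l) * x + l * y)) c := by
        gcongr
        apply le_min (H x y)
        rw [hc]; gcongr
        · exact hfa x
        · exact hgb y
      _ = _ := by rw [ENNReal.div_eq_inv_mul]

/-- Prekopa-Leindler property of a measure. -/
def HasPL {E : Type*} [AddCommGroup E] [Module ℝ E] [MeasurableSpace E] (μ : Measure E) : Prop :=
  ∀ l : ℝ, 0 < l → l < 1 → ∀ f g h : E → ENNReal, Measurable f → Measurable g → Measurable h →
    (∀ x y, f x ^ (1 - l) * g y ^ l ≤ h ((1 - l) • x + l • y)) →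
    (∫⁻ x, f x ∂μ) ^ (1 - l) * (∫⁻ x, g x ∂μ) ^ l ≤ ∫⁻ x, h x ∂μ

open Filter Topology in
lemma hasPL_real : HasPL (volume : Measure ℝ) := by
  intro l h0 h1 f g h hf hg hh H
  have h1' : 0 < 1 - l := by linarith
  by_cases hf0 : ∫⁻ x, f x = 0
  · simp [hf0, h1']
  by_cases hg0 : ∫⁻ x, g x = 0
  · simp [hg0, h0]
  have tend : ∀ f : ℝ → ENNReal, Measurable f →
      Tendsto (fun n : ℕ => ∫⁻ x, min (f x) n) atTop (𝓝 (∫⁻ x, f x)) := by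
    intro f hf
    apply lintegral_tendsto_of_tendsto_of_monotone
    · intro n; fun_prop
    · refine ae_of_all _ fun x m n hmn => ?_
      apply min_le_min le_rfl; exact_mod_cast hmn
    · refine ae_of_all _ fun x => ?_
      have := (tendsto_const_nhds (x := f x)).min ENNReal.tendsto_nat_nhds_top
      simpa using this
  have t1 := (tend f hf).ennrpow_const (1 - l)
  have t2 := (tend g hg).ennrpow_const l
  have t3 := ENNReal.Tendsto.mul t1 (Or.inl (by simp [hf0]; intro _; linarith)) t2 (Or.inl (by simp [hg0]; intro _; linarith))
  refine le_of_tendsto t3 (Eventually.of_forall fun n => ?_)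
  apply aux_pl_bdd l h0 h1 _ _ h (by fun_prop) (by fun_prop) hh n (by simp)
    (fun x => min_le_right _ _) (fun x => min_le_right _ _)
  intro x y
  refine le_trans ?_ (H x y)
  gcongr <;> exact min_le_left _ _

lemma HasPL.prod {E F : Type*} [AddCommGroup E] [Module ℝ E] [MeasurableSpace E]
    [AddCommGroup F] [Module ℝ F] [MeasurableSpace F] {μ : Measure E} {ν : Measure F}
    [SFinite μ] [SFinite ν] (hμ : HasPL μ) (hν : HasPL ν) : HasPL (μ.prod ν) := by
  intro l h0 h1 f g h hf hg hh H
  rw [lintegral_prod _ hf.aemeasurable, lintegral_prod _ hg.aemeasurable,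
    lintegral_prod _ hh.aemeasurable]
  apply hμ l h0 h1 _ _ _ hf.lintegral_prod_right' hg.lintegral_prod_right' hh.lintegral_prod_right'
  intro x x'
  apply hν l h0 h1 _ _ _ (by fun_prop) (by fun_prop) (by fun_prop)
  intro y y'
  exact H (x, y) (x', y')

lemma HasPL.map {E F : Type*} [AddCommGroup E] [Module ℝ E] [MeasurableSpace E]
    [AddCommGroup F] [Module ℝ F] [MeasurableSpace F] {μ : Measure E}
    (hμ : HasPL μ) (e : E →ₗ[ℝ] F) (he : Measurable e) : HasPL (μ.map e) := by
  intro l h0 h1 f g h hf hg hh H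
  rw [lintegral_map hf he, lintegral_map hg he, lintegral_map hh he]
  apply hμ l h0 h1 _ _ _ (by fun_prop) (by fun_prop) (by fun_prop)
  intro x y
  simpa using H (e x) (e y)

lemma HasPL.smul {E : Type*} [AddCommGroup E] [Module ℝ E] [MeasurableSpace E] {μ : Measure E}
    (hμ : HasPL μ) (c : ENNReal) (hc0 : c ≠ 0) (hc : c ≠ ⊤) : HasPL (c • μ) := by
  intro l h0 h1 f g h hf hg hh H
  simp only [lintegral_smul_measure, smul_eq_mul]
  rw [ENNReal.mul_rpow_of_nonneg _ _ (by linarith), ENNReal.mul_rpow_of_nonneg _ _ h0.le]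
  calc _ = (c ^ (1 - l) * c ^ l) * ((∫⁻ x, f x ∂μ) ^ (1 - l) * (∫⁻ x, g x ∂μ) ^ l) := by ring
    _ = c * ((∫⁻ x, f x ∂μ) ^ (1 - l) * (∫⁻ x, g x ∂μ) ^ l) := by
      rw [← ENNReal.rpow_add _ _ hc0 hc]; simp
    _ ≤ _ := by gcongr; exact hμ l h0 h1 f g h hf hg hh H

lemma exists_haar_smul {E : Type*} [NormedAddCommGroup E] [NormedSpace ℝ E] [FiniteDimensional ℝ E]
    [MeasurableSpace E] [BorelSpace E] (μ ν : Measure E) [μ.IsAddHaarMeasure] [ν.IsAddHaarMeasure] :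
    ∃ c : ENNReal, c ≠ 0 ∧ c ≠ ⊤ ∧ μ = c • ν := by
  refine ⟨Measure.addHaarScalarFactor μ ν, ?_, by simp, ?_⟩
  · have := Measure.addHaarScalarFactor_pos_of_isAddHaarMeasure μ ν
    exact_mod_cast this.ne'
  · exact Measure.isAddLeftInvariant_eq_smul μ ν

abbrev E3 := EuclideanSpace ℝ (Fin 3)

lemma hasPL_E3 : HasPL (volume : Measure E3) := by
  have h3 : HasPL (volume.prod (volume.prod volume) : Measure (ℝ × ℝ × ℝ)) :=
    hasPL_real.prod (hasPL_real.prod hasPL_real)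
  have hh2 : (volume.prod volume : Measure (ℝ × ℝ)).IsAddHaarMeasure :=
    Measure.prod.instIsAddHaarMeasure _ _
  have hh3 : (volume.prod (volume.prod volume) : Measure (ℝ × ℝ × ℝ)).IsAddHaarMeasure :=
    Measure.prod.instIsAddHaarMeasure _ _
  have e : (ℝ × ℝ × ℝ) ≃L[ℝ] E3 := ContinuousLinearEquiv.ofFinrankEq (by simp)
  have h4 := h3.map (e : (ℝ × ℝ × ℝ) →ₗ[ℝ] E3) e.continuous.measurable
  have : ((volume.prod (volume.prod volume) : Measure (ℝ × ℝ × ℝ)).map e).IsAddHaarMeasure :=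
    e.isAddHaarMeasure_map _
  obtain ⟨c, hc0, hc, h⟩ := exists_haar_smul (volume : Measure E3)
    ((volume.prod (volume.prod volume) : Measure (ℝ × ℝ × ℝ)).map e)
  rw [h]
  exact h4.smul c hc0 hc

lemma bm_set (l : ℝ) (h0 : 0 < l) (h1 : l < 1) (A B C : Set E3) (hA : MeasurableSet A)
    (hB : MeasurableSet B) (hC : MeasurableSet C) (hCf : volume C ≠ ⊤)
    (H : ∀ x ∈ A, ∀ y ∈ B, (1 - l) • x + l • y ∈ C) :
    (volume.real A) ^ (1 - l) * (volume.real B) ^ l ≤ volume.real C := by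
  have h1' : 0 < 1 - l := by linarith
  have := hasPL_E3 l h0 h1 (A.indicator 1) (B.indicator 1) (C.indicator 1)
    (measurable_one.indicator hA) (measurable_one.indicator hB) (measurable_one.indicator hC) ?_
  · rw [lintegral_indicator_one hA, lintegral_indicator_one hB, lintegral_indicator_one hC] at this
    have := ENNReal.toReal_mono hCf this
    rw [ENNReal.toReal_mul, ← ENNReal.toReal_rpow, ← ENNReal.toReal_rpow] at this
    exact this
  · intro x y
    by_cases hx : x ∈ A
    · by_cases hy : y ∈ B
      · simp [hx, hy, H x hx y hy]
      · simp [hy, h0]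
    · simp [hx, h1']

/-- Splitting of the space along a unit vector. -/
def spl (u : E3) (hu : ‖u‖ = 1) : (ℝ × (ℝ ∙ u)ᗮ) ≃L[ℝ] E3 :=
  LinearEquiv.toContinuousLinearEquiv
  { toFun := fun p => p.1 • u + p.2
    map_add' := by intro p q; simp; module
    map_smul' := by intro r p; simp; module
    invFun := fun x => (inner ℝ u x, ⟨x - (inner ℝ u x : ℝ) • u, by
      rw [Submodule.mem_orthogonal_singleton_iff_inner_right]
      simp [inner_sub_right, inner_smul_right, hu]⟩)
    left_inv := by
      rintro ⟨s, w, hw⟩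
      rw [Submodule.mem_orthogonal_singleton_iff_inner_right] at hw
      simp [inner_add_right, inner_smul_right, hu, hw]
    right_inv := by intro x; simp }

lemma spl_apply (u : E3) (hu : ‖u‖ = 1) (p : ℝ × (ℝ ∙ u)ᗮ) : spl u hu p = p.1 • u + p.2 := rfl

lemma inner_spl (u : E3) (hu : ‖u‖ = 1) (p : ℝ × (ℝ ∙ u)ᗮ) : inner ℝ u (spl u hu p) = p.1 := by
  rw [spl_apply]
  have := (Submodule.mem_orthogonal_singleton_iff_inner_right).1 p.2.2
  simp [inner_add_right, inner_smul_right, hu, this]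

lemma finrank_perp (u : E3) (hu : ‖u‖ = 1) : Module.finrank ℝ (ℝ ∙ u)ᗮ = 2 := by
  have : Fact (Module.finrank ℝ E3 = 2 + 1) := ⟨by simp⟩
  exact Submodule.finrank_orthogonal_span_singleton (by intro h; simp [h] at hu)

lemma haar_perp (u : E3) (hu : ‖u‖ = 1) : (μH[2] : Measure (ℝ ∙ u)ᗮ).IsAddHaarMeasure := by
  have h := isAddHaarMeasure_hausdorffMeasure (E := (ℝ ∙ u)ᗮ)
  rw [finrank_perp u hu] at h
  exact_mod_cast h

lemma spl_vol (u : E3) (hu : ‖u‖ = 1) : ∃ c : ENNReal, c ≠ 0 ∧ c ≠ ⊤ ∧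
    ∀ S : Set E3, volume S = c * (volume.prod (μH[2] : Measure (ℝ ∙ u)ᗮ)) (spl u hu ⁻¹' S) := by
  have := haar_perp u hu
  have : ((volume.prod (μH[2] : Measure (ℝ ∙ u)ᗮ)).map (spl u hu)).IsAddHaarMeasure :=
    (spl u hu).isAddHaarMeasure_map _
  obtain ⟨c, hc0, hc, h⟩ := exists_haar_smul (volume : Measure E3)
    ((volume.prod (μH[2] : Measure (ℝ ∙ u)ᗮ)).map (spl u hu))
  refine ⟨c, hc0, hc, fun S => ?_⟩
  rw [h, Measure.smul_apply, smul_eq_mul]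
  congr 1
  exact (spl u hu).toHomeomorph.toMeasurableEquiv.map_apply S

lemma slice_hausdorff (u : E3) (hu : ‖u‖ = 1) (h : ℝ) (F : Set E3)
    (hF : ∀ x ∈ F, inner ℝ u x = h) :
    μH[2] F = μH[2] {w : (ℝ ∙ u)ᗮ | spl u hu (h, w) ∈ F} := by
  have hi : Isometry (fun w : (ℝ ∙ u)ᗮ => spl u hu (h, w)) := by
    refine Isometry.of_dist_eq fun x y => ?_
    simp [spl_apply, Subtype.dist_eq]
  rw [← hi.hausdorffMeasure_image (Or.inl (by norm_num))]
  congr 1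
  ext x
  constructor
  · intro hx
    obtain ⟨⟨s, w⟩, rfl⟩ := (spl u hu).surjective x
    have : s = h := by rw [← hF _ hx, inner_spl]
    subst this
    exact ⟨w, hx, rfl⟩
  · rintro ⟨w, hw, rfl⟩; exact hw

lemma slice_finite (u : E3) (hu : ‖u‖ = 1) (h : ℝ) (F : Set E3)
    (hF : ∀ x ∈ F, inner ℝ u x = h) (hFc : IsCompact F) : μH[2] F ≠ ⊤ := by
  have := haar_perp u hu
  rw [slice_hausdorff u hu h F hF]
  have : IsCompact {w : (ℝ ∙ u)ᗮ | spl u hu (h, w) ∈ F} := by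
    have h2 : {w : (ℝ ∙ u)ᗮ | spl u hu (h, w) ∈ F} ⊆ (fun x => ((spl u hu).symm x).2) '' F := by
      intro w hw
      exact ⟨_, hw, by simp⟩
    refine (hFc.image (by fun_prop)).of_isClosed_subset ?_ h2
    exact hFc.isClosed.preimage (f := fun w => spl u hu (h, w)) (by fun_prop)
  exact this.measure_lt_top.ne

open Set Pointwise in
lemma slab_ub (u : E3) (hu : ‖u‖ = 1) (c : ENNReal)
    (hc : ∀ S : Set E3, volume S = c * (volume.prod (μH[2] : Measure (ℝ ∙ u)ᗮ)) (spl u hu ⁻¹' S))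
    (K : Set E3) (hK : IsCompact K) (h : ℝ) (hKh : ∀ x ∈ K, inner ℝ u x ≤ h)
    (r : ENNReal) (hr : μH[2] {x ∈ K | inner ℝ u x = h} < r) :
    ∃ t0 > 0, ∀ t : ℝ, 0 < t → t < t0 → ∀ k : ℝ,
      volume {x | x ∈ (1 + t) • K ∧ h < inner ℝ u x ∧ inner ℝ u x ≤ h + k} ≤
        ENNReal.ofReal k * (c * r) := by
  have := haar_perp u hu
  rw [slice_hausdorff u hu h _ (by simp)] at hr
  obtain ⟨V, hV, hVo, hVr⟩ := exists_isOpen_lt_of_lt _ _ hr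
  set pr : E3 → (ℝ ∙ u)ᗮ := fun x => ((spl u hu).symm x).2 with hpr
  have prc : Continuous pr := by fun_prop
  have hcpt : IsCompact ((Icc (0:ℝ) 1 ×ˢ K) ∩
      {p : ℝ × E3 | pr ((1 + p.1) • p.2) ∈ Vᶜ ∧ h ≤ inner ℝ u ((1 + p.1) • p.2)}) := by
    refine (isCompact_Icc.prod hK).inter_right (IsClosed.inter ?_ ?_)
    · exact hVo.isClosed_compl.preimage (f := fun p : ℝ × E3 => pr ((1 + p.1) • p.2)) (by fun_prop)
    · exact isClosed_le (f := fun _ : ℝ × E3 => h) (g := fun p : ℝ × E3 => inner ℝ u ((1 + p.1) • p.2)) (by fun_prop) (by fun_prop)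
  have hpos : ∃ t0 > 0, ∀ t : ℝ, 0 < t → t < t0 → ∀ x ∈ (1 + t) • K, h ≤ inner ℝ u x → pr x ∈ V := by
    rcases eq_empty_or_nonempty ((Icc (0:ℝ) 1 ×ˢ K) ∩
      {p : ℝ × E3 | pr ((1 + p.1) • p.2) ∈ Vᶜ ∧ h ≤ inner ℝ u ((1 + p.1) • p.2)}) with he | hne
    · refine ⟨1, one_pos, ?_⟩
      rintro t ht ht1 _ ⟨x, hx, rfl⟩ hh
      by_contra hcon
      have : (t, x) ∈ (∅ : Set (ℝ × E3)) := by
        rw [← he]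
        exact ⟨⟨⟨ht.le, ht1.le⟩, hx⟩, hcon, hh⟩
      exact this
    · obtain ⟨⟨s, y⟩, ⟨⟨hs, hy⟩, hyV, hyh⟩, hmin⟩ := hcpt.exists_isMinOn hne continuous_fst.continuousOn
      have hs0 : 0 < s := by
        rcases hs.1.lt_or_eq with h' | h'
        · exact h'
        · exfalso
          subst h'
          simp only [add_zero, one_smul] at hyV hyh
          apply hyV
          apply hV
          have : inner ℝ u y = h := le_antisymm (hKh y hy) hyh
          have e : spl u hu (h, pr y) = y := by
            rw [← this]
            apply (spl u hu).symm.injective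
            rw [ContinuousLinearEquiv.symm_apply_apply]
            ext1
            · have h5 := inner_spl u hu ((spl u hu).symm y)
              rwa [ContinuousLinearEquiv.apply_symm_apply] at h5
            · rfl
          change spl u hu (h, pr y) ∈ {x | x ∈ K ∧ inner ℝ u x = h}
          rw [e]
          exact ⟨hy, this⟩
      refine ⟨s, hs0, ?_⟩
      rintro t ht hts _ ⟨x, hx, rfl⟩ hh
      by_contra hcon
      have : s ≤ t := hmin (a := (t, x)) ⟨⟨⟨ht.le, hts.le.trans hs.2⟩, hx⟩, hcon, hh⟩
      linarith
  obtain ⟨t0, ht0, H⟩ := hpos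
  refine ⟨t0, ht0, fun t ht htt k => ?_⟩
  rw [hc]
  calc _ ≤ c * (volume.prod (μH[2] : Measure (ℝ ∙ u)ᗮ)) (Ioc h (h + k) ×ˢ V) := by
        gcongr
        rintro ⟨s, w⟩ ⟨h1, h2, h3⟩
        rw [inner_spl] at h2 h3
        refine ⟨⟨h2, h3⟩, ?_⟩
        have := H t ht htt _ h1 (by rw [inner_spl]; exact h2.le)
        simpa [hpr] using this
    _ = c * (ENNReal.ofReal k * μH[2] V) := by
        rw [Measure.prod_prod]; simp
    _ ≤ c * (ENNReal.ofReal k * r) := by gcongr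
    _ = _ := by ring

open Set in
lemma cone_vol (u : E3) (hu : ‖u‖ = 1) (c : ENNReal)
    (hc : ∀ S : Set E3, volume S = c * (volume.prod (μH[2] : Measure (ℝ ∙ u)ᗮ)) (spl u hu ⁻¹' S))
    (F : Set E3) (hF : IsClosed F) (h : ℝ) (hh : 0 < h) (hFh : ∀ x ∈ F, inner ℝ u x = h) :
    MeasurableSet {x : E3 | 0 < inner ℝ u x ∧ inner ℝ u x ≤ h ∧ (h / inner ℝ u x) • x ∈ F} ∧
    volume {x : E3 | 0 < inner ℝ u x ∧ inner ℝ u x ≤ h ∧ (h / inner ℝ u x) • x ∈ F} =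
      ENNReal.ofReal (h / 3) * (c * μH[2] F) := by
  have := haar_perp u hu
  have hm : MeasurableSet {x : E3 | 0 < inner ℝ u x ∧ inner ℝ u x ≤ h ∧ (h / inner ℝ u x) • x ∈ F} := by
    refine (measurableSet_lt (f := fun _ : E3 => (0:ℝ)) (g := fun x : E3 => inner ℝ u x) measurable_const
        (by fun_prop)).inter
      ((measurableSet_le (f := fun x : E3 => inner ℝ u x) (g := fun _ : E3 => h) (by fun_prop)
        measurable_const).inter ?_)
    have : Measurable (fun x : E3 => (h / inner ℝ u x : ℝ) • x) := by fun_prop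
    exact this hF.measurableSet
  refine ⟨hm, ?_⟩
  rw [hc, Measure.prod_apply ((spl u hu).continuous.measurable hm), slice_hausdorff u hu h F hFh]
  set A := μH[2] {w : (ℝ ∙ u)ᗮ | spl u hu (h, w) ∈ F}
  have e : ∀ s : ℝ, μH[2] (Prod.mk s ⁻¹' (spl u hu ⁻¹' {x : E3 | 0 < inner ℝ u x ∧ inner ℝ u x ≤ h ∧ (h / inner ℝ u x) • x ∈ F}))
      = (Ioc 0 h).indicator (fun s => ENNReal.ofReal (s ^ 2 / h ^ 2) * A) s := by
    intro s
    by_cases hs : s ∈ Ioc 0 h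
    · rw [indicator_of_mem hs]
      have : (Prod.mk s ⁻¹' (spl u hu ⁻¹' {x : E3 | 0 < inner ℝ u x ∧ inner ℝ u x ≤ h ∧ (h / inner ℝ u x) • x ∈ F}))
        = (fun w => (h / s) • w) ⁻¹' {w : (ℝ ∙ u)ᗮ | spl u hu (h, w) ∈ F} := by
        ext w
        simp only [mem_preimage, mem_ofPred_eq, inner_spl]
        have : (h / s) • spl u hu (s, w) = spl u hu (h, (h / s) • w) := by
          rw [← map_smul]; congr 1
          ext1
          · simp; field_simp [hs.1.ne']
          · rfl
        rw [this]
        simp [hs.1, hs.2]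
      rw [this, Measure.addHaar_preimage_smul _ (by have := hs.1; positivity), finrank_perp u hu]
      congr 2
      have := hs.1
      rw [abs_of_nonneg (by positivity)]
      field_simp
    · rw [indicator_of_notMem hs]
      convert measure_empty (μ := (μH[2] : Measure (ℝ ∙ u)ᗮ))
      ext w
      simp only [mem_preimage, mem_ofPred_eq, inner_spl, mem_empty_iff_false, iff_false]
      rintro ⟨h1, h2, -⟩
      exact hs ⟨h1, h2⟩
  simp_rw [e]
  rw [lintegral_indicator measurableSet_Ioc, lintegral_mul_const _ (by fun_prop)]
  have e2 : ∫⁻ s in Ioc 0 h, ENNReal.ofReal (s ^ 2 / h ^ 2) = ENNReal.ofReal (h / 3) := by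
    rw [← ofReal_integral_eq_lintegral_ofReal]
    · congr 1
      rw [← intervalIntegral.integral_of_le hh.le, intervalIntegral.integral_div, integral_pow]
      field_simp; norm_num; ring
    · exact (Continuous.integrableOn_Icc (by fun_prop)).mono_set Ioc_subset_Icc_self
    · exact ae_of_all _ fun s => by positivity
  rw [e2]; ring

/-- Distribution functions with log-concave lower and upper tails. -/
structure LC (F : ℝ → ℝ) : Prop where
  cont : Continuous F
  mono : Monotone F
  nonneg : ∀ s, 0 ≤ F s
  le_one : ∀ s, F s ≤ 1
  ex0 : ∃ a, F a = 0
  ex1 : ∃ b, F b = 1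
  lc : ∀ l : ℝ, 0 < l → l < 1 → ∀ x y, F x ^ (1 - l) * F y ^ l ≤ F ((1 - l) * x + l * y)
  lc' : ∀ l : ℝ, 0 < l → l < 1 → ∀ x y,
    (1 - F x) ^ (1 - l) * (1 - F y) ^ l ≤ 1 - F ((1 - l) * x + l * y)

lemma LC.surj {F : ℝ → ℝ} (h : LC F) (t : ℝ) (h0 : 0 ≤ t) (h1 : t ≤ 1) : ∃ s, F s = t := by
  obtain ⟨a, ha⟩ := h.ex0
  obtain ⟨b, hb⟩ := h.ex1
  exact mem_range_of_exists_le_of_exists_ge h.cont ⟨a, by linarith⟩ ⟨b, by linarith⟩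

lemma convexOn_neg_log (D : Set ℝ) (hD : Convex ℝ D) (F : ℝ → ℝ) (hF : ∀ x ∈ D, 0 < F x)
    (h : ∀ l : ℝ, 0 < l → l < 1 → ∀ x y, F x ^ (1 - l) * F y ^ l ≤ F ((1 - l) * x + l * y)) :
    ConvexOn ℝ D (fun s => - Real.log (F s)) := by
  rw [convexOn_iff_forall_pos]
  refine ⟨hD, ?_⟩
  intro x hx y hy a b ha hb hab
  have hl := h b hb (by linarith) x y
  have e : 1 - b = a := by linarith
  rw [e] at hl
  have h2 := Real.log_le_log (by have := hF x hx; have := hF y hy; positivity) hl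
  rw [Real.log_mul (by have := hF x hx; positivity) (by have := hF y hy; positivity),
    Real.log_rpow (hF x hx), Real.log_rpow (hF y hy)] at h2
  simp only [smul_eq_mul]
  linarith

lemma conv_log (F : ℝ → ℝ) (hF : Continuous F) (S : Set ℝ) (s a : ℝ) (h0 : 0 < F s)
    (ha : HasDerivWithinAt (fun s => - Real.log (F s)) a S s) :
    HasDerivWithinAt F (- F s * a) S s := by
  have h2 := ha.neg.exp
  simp only [Pi.neg_apply, neg_neg, Real.exp_log h0] at h2
  rw [mul_neg, ← neg_mul] at h2
  refine h2.congr_of_eventuallyEq ?_ (by rw [Real.exp_log h0])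
  apply eventually_nhdsWithin_of_eventually_nhds
  filter_upwards [hF.continuousAt.eventually (lt_mem_nhds h0)] with x hx
  rw [Real.exp_log hx]

open Set in
lemma LC.deriv {F : ℝ → ℝ} (h : LC F) (s : ℝ) (h0 : 0 < F s) (h1 : F s < 1) :
    ∃ p > 0, HasDerivAt F p s := by
  set D : Set ℝ := {x | 0 < F x ∧ F x < 1} with hDdef
  have hDo : IsOpen D := (isOpen_lt continuous_const h.cont).inter (isOpen_lt h.cont continuous_const)
  have hDc : Convex ℝ D := by
    apply OrdConnected.convex
    refine ⟨fun x hx y hy z hz => ⟨hx.1.trans_le (h.mono hz.1), (h.mono hz.2).trans_lt hy.2⟩⟩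
  have hsD : s ∈ D := ⟨h0, h1⟩
  have hsi : s ∈ interior D := by rwa [hDo.interior_eq]
  have hA := convexOn_neg_log D hDc F (fun x hx => hx.1) h.lc
  have hB := convexOn_neg_log D hDc (fun x => 1 - F x) (fun x hx => by linarith [hx.2]) h.lc'
  have A1 := hA.hasDerivWithinAt_rightDeriv_of_mem_interior hsi
  have A2 := hA.hasDerivWithinAt_leftDeriv_of_mem_interior hsi
  have A3 := hA.leftDeriv_le_rightDeriv_of_mem_interior hsi
  have B1 := hB.hasDerivWithinAt_rightDeriv_of_mem_interior hsi
  have B2 := hB.hasDerivWithinAt_leftDeriv_of_mem_interior hsi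
  have B3 := hB.leftDeriv_le_rightDeriv_of_mem_interior hsi
  obtain ⟨y, hy⟩ := h.surj ((F s + 1) / 2) (by linarith) (by linarith)
  have hyD : y ∈ D := ⟨by linarith, by linarith⟩
  have hsy : s < y := by
    by_contra hcon
    push Not at hcon
    have := h.mono hcon
    linarith
  have A4 := hA.rightDeriv_le_slope_of_mem_interior hsi hyD hsy
  have A5 : slope (fun s => - Real.log (F s)) s y < 0 := by
    rw [slope_def_field]
    apply div_neg_of_neg_of_pos
    · have := Real.log_lt_log h0 (by linarith : F s < F y)
      linarith
    · linarith
  set ar := derivWithin (fun s => - Real.log (F s)) (Ioi s) s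
  set al := derivWithin (fun s => - Real.log (F s)) (Iio s) s
  set br := derivWithin (fun s => - Real.log (1 - F s)) (Ioi s) s
  set bl := derivWithin (fun s => - Real.log (1 - F s)) (Iio s) s
  have convA : ∀ (S : Set ℝ) (a : ℝ), HasDerivWithinAt (fun s => - Real.log (F s)) a S s →
      HasDerivWithinAt F (- F s * a) S s :=
    fun S a ha => conv_log F h.cont S s a h0 ha
  have convB : ∀ (S : Set ℝ) (a : ℝ), HasDerivWithinAt (fun s => - Real.log (1 - F s)) a S s →
      HasDerivWithinAt F ((1 - F s) * a) S s := by
    intro S a ha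
    have h2 := (conv_log (fun x => 1 - F x) (by have := h.cont; fun_prop) S s a (by linarith) ha).const_sub 1
    have e : (fun x => 1 - (1 - F x)) = F := by ext x; ring
    have e2 : -(-(1 - F s) * a) = (1 - F s) * a := by ring
    rw [e, e2] at h2
    exact h2
  have r1 := convA _ _ A1
  have r2 := convB _ _ B1
  have l1 := convA _ _ A2
  have l2 := convB _ _ B2
  have er : - F s * ar = (1 - F s) * br :=
    (uniqueDiffWithinAt_Ioi s).eq_deriv _ r1 r2
  have el : - F s * al = (1 - F s) * bl :=
    (uniqueDiffWithinAt_Iio s).eq_deriv _ l1 l2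
  have hb1 : (1 - F s) * bl ≤ (1 - F s) * br := by
    apply mul_le_mul_of_nonneg_left B3; linarith
  have ha1 : F s * al ≤ F s * ar := mul_le_mul_of_nonneg_left A3 h0.le
  have eq : - F s * al = - F s * ar := by linarith
  refine ⟨- F s * ar, ?_, ?_⟩
  · have : ar < 0 := by linarith
    nlinarith
  · rw [eq] at l1
    have := (hasDerivWithinAt_Iio_iff_Iic.1 l1).union (hasDerivWithinAt_Ioi_iff_Ici.1 r1)
    rwa [Iic_union_Ici, hasDerivWithinAt_univ] at this

open Set Topology in
lemma LC.quant {F : ℝ → ℝ} (h : LC F) : ∃ S : ℝ → ℝ, ∀ t ∈ Ioo (0:ℝ) 1, F (S t) = t ∧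
    ∀ p, HasDerivAt F p (S t) → p ≠ 0 → HasDerivAt S p⁻¹ t := by
  have hs : ∀ t : ℝ, t ∈ Ioo (0:ℝ) 1 → ∃ s, F s = t := fun t ht => h.surj t ht.1.le ht.2.le
  choose! S hS using hs
  refine ⟨S, fun t ht => ⟨hS t ht, fun p hp hp0 => ?_⟩⟩
  have hIoo : Ioo (0:ℝ) 1 ∈ 𝓝 t := Ioo_mem_nhds ht.1 ht.2
  set D : Set ℝ := {x | 0 < F x ∧ F x < 1} with hDdef
  have hDo : IsOpen D := (isOpen_lt continuous_const h.cont).inter (isOpen_lt h.cont continuous_const)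
  have hDc : Convex ℝ D := by
    apply OrdConnected.convex
    refine ⟨fun x hx y hy z hz => ⟨hx.1.trans_le (h.mono hz.1), (h.mono hz.2).trans_lt hy.2⟩⟩
  have hstrict : StrictMonoOn F D := by
    apply strictMonoOn_of_deriv_pos hDc h.cont.continuousOn
    intro x hx
    rw [hDo.interior_eq] at hx
    obtain ⟨p, hp, hd⟩ := h.deriv x hx.1 hx.2
    rwa [hd.deriv]
  have hSmono : StrictMonoOn S (Ioo 0 1) := by
    intro x hx y hy hxy
    by_contra hcon
    push Not at hcon
    have := h.mono hcon
    rw [hS x hx, hS y hy] at this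
    linarith
  have himg : S '' (Ioo 0 1) ∈ 𝓝 (S t) := by
    apply Filter.mem_of_superset (hDo.mem_nhds (show S t ∈ D by
      show 0 < F (S t) ∧ F (S t) < 1
      rw [hS t ht]; exact ht))
    intro x hx
    refine ⟨F x, hx, ?_⟩
    have e := hS (F x) hx
    apply hstrict.injOn _ hx e
    show 0 < F (S (F x)) ∧ F (S (F x)) < 1
    rw [e]; exact hx
  apply HasDerivAt.of_local_left_inverse (hSmono.continuousAt_of_image_mem_nhds hIoo himg) hp hp0
  filter_upwards [hIoo] with y hy using hS y hy

open Set in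
lemma oneD (F G H : ℝ → ℝ) (hF : LC F) (hG : LC G) (hH0 : ∀ x, 0 ≤ H x) (hH1 : ∀ x, H x ≤ 1)
    (m1 : ∀ s t, F s * G t ≤ H ((s + t) / 2) ^ 2)
    (m2 : ∀ s t, (1 - F s) * (1 - G t) ≤ (1 - H ((s + t) / 2)) ^ 2) :
    ∃ c, ∀ t, F (t + c) = G t := by
  obtain ⟨S, hS⟩ := hF.quant
  obtain ⟨T, hT⟩ := hG.quant
  have key : ∀ t ∈ Ioo (0:ℝ) 1, HasDerivAt (fun t => S t - T t) 0 t := by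
    intro t ht
    obtain ⟨S1, S2⟩ := hS t ht
    obtain ⟨T1, T2⟩ := hT t ht
    obtain ⟨p, hp, hFp⟩ := hF.deriv (S t) (by rw [S1]; exact ht.1) (by rw [S1]; exact ht.2)
    obtain ⟨q, hq, hGq⟩ := hG.deriv (T t) (by rw [T1]; exact ht.1) (by rw [T1]; exact ht.2)
    have hHt : H ((S t + T t) / 2) = t := by
      have a1 := m1 (S t) (T t)
      have a2 := m2 (S t) (T t)
      rw [S1, T1] at a1 a2
      have b1 := hH0 ((S t + T t) / 2)
      have b2 := hH1 ((S t + T t) / 2)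
      have c1 : t ≤ H ((S t + T t) / 2) := by
        apply le_of_sq_le_sq _ b1; linarith
      have c2 : 1 - t ≤ 1 - H ((S t + T t) / 2) := by
        apply le_of_sq_le_sq _ (by linarith); linarith
      linarith
    have hmax : IsLocalMax (fun e => F (S t + e) * G (T t - e)) 0 := by
      refine Filter.Eventually.of_forall fun e => ?_
      have := m1 (S t + e) (T t - e)
      rw [show (S t + e + (T t - e)) / 2 = (S t + T t) / 2 by ring, hHt] at this
      simp only [add_zero, sub_zero, S1, T1]
      linarith
    have d1 : HasDerivAt (fun e => F (S t + e)) p 0 := by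
      have : HasDerivAt F p (S t + 0) := by simpa using hFp
      exact this.comp_const_add _ _
    have d2 : HasDerivAt (fun e => G (T t - e)) (-q) 0 := by
      have : HasDerivAt G q (T t - 0) := by simpa using hGq
      exact this.comp_const_sub _ _
    have d3 := hmax.hasDerivAt_eq_zero (d1.mul d2)
    simp only [add_zero, sub_zero, S1, T1] at d3
    have hpq : p = q := by
      have : t * (p - q) = 0 := by linarith
      rcases mul_eq_zero.1 this with h | h
      · linarith [ht.1]
      · linarith
    subst hpq
    have := (S2 p hFp hp.ne').sub (T2 p hGq hp.ne')
    rw [sub_self] at this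
    exact this
  obtain ⟨c, hc⟩ := isOpen_Ioo.exists_is_const_of_deriv_eq_zero (s := Ioo (0:ℝ) 1) isPreconnected_Ioo
    (f := fun t => S t - T t) (fun t ht => (key t ht).differentiableAt.differentiableWithinAt)
    (fun t ht => (key t ht).deriv)
  refine ⟨c, fun t => ?_⟩
  apply le_antisymm
  · by_contra hcon
    push Not at hcon
    obtain ⟨τ, h1, h2⟩ := exists_between hcon
    have hτ : τ ∈ Ioo (0:ℝ) 1 := ⟨(hG.nonneg t).trans_lt h1, h2.trans_le (hF.le_one _)⟩
    have a1 : t < T τ := by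
      by_contra h'
      push Not at h'
      have := hG.mono h'
      rw [(hT τ hτ).1] at this; linarith
    have a2 := hF.mono (show t + c ≤ S τ by have := hc τ hτ; linarith)
    rw [(hS τ hτ).1] at a2
    linarith
  · by_contra hcon
    push Not at hcon
    obtain ⟨τ, h1, h2⟩ := exists_between hcon
    have hτ : τ ∈ Ioo (0:ℝ) 1 := ⟨(hF.nonneg _).trans_lt h1, h2.trans_le (hG.le_one _)⟩
    have a1 : T τ < t := by
      by_contra h'
      push Not at h'
      have := hG.mono h'
      rw [(hT τ hτ).1] at this; linarith
    have a2 := hF.mono (show S τ ≤ t + c by have := hc τ hτ; linarith)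
    rw [(hS τ hτ).1] at a2
    linarith

structure PolyH (U : Finset E3) (K : Set E3) (h : E3 → ℝ) : Prop where
  unit : ∀ u ∈ U, ‖u‖ = 1
  cpt : IsCompact K
  zero : (0 : E3) ∈ interior K
  eq : K = {x | ∀ u ∈ U, inner ℝ u x ≤ h u}
  att : ∀ u ∈ U, ∃ x ∈ K, inner ℝ u x = h u

def cc (u : E3) : ENNReal := if hu : ‖u‖ = 1 then (spl_vol u hu).choose else 0

lemma cc_spec (u : E3) (hu : ‖u‖ = 1) : cc u ≠ 0 ∧ cc u ≠ ⊤ ∧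
    ∀ S : Set E3, volume S = cc u * (volume.prod (μH[2] : Measure (ℝ ∙ u)ᗮ)) (spl u hu ⁻¹' S) := by
  unfold cc
  rw [dif_pos hu]
  exact (spl_vol u hu).choose_spec

def face (K : Set E3) (h : E3 → ℝ) (u : E3) : Set E3 := {x ∈ K | inner ℝ u x = h u}

def ar (u : E3) (F : Set E3) : ℝ := (cc u * μH[2] F).toReal

lemma PolyH.le {U K h} (P : PolyH U K h) {x} (hx : x ∈ K) {u} (hu : u ∈ U) : inner ℝ u x ≤ h u := by
  rw [P.eq] at hx
  exact hx u hu

lemma PolyH.mem {U K h} (P : PolyH U K h) {x} (hx : ∀ u ∈ U, inner ℝ u x ≤ h u) : x ∈ K := by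
  rw [P.eq]; exact hx

lemma PolyH.conv {U K h} (P : PolyH U K h) : Convex ℝ K := by
  intro x hx y hy a b ha hb hab
  refine P.mem fun u hu => ?_
  have h1 := P.le hx hu
  have h2 := P.le hy hu
  rw [inner_add_right, inner_smul_right, inner_smul_right]
  have : b = 1 - a := by linarith
  subst this
  nlinarith

lemma PolyH.pos {U K h} (P : PolyH U K h) {u} (hu : u ∈ U) : 0 < h u := by
  have h0 := mem_interior_iff_mem_nhds.1 P.zero
  obtain ⟨e, he, hb⟩ := Metric.mem_nhds_iff.1 h0
  have : (e / 2) • u ∈ K := by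
    apply hb
    rw [mem_ball_zero_iff, norm_smul, P.unit u hu, Real.norm_eq_abs, abs_of_pos (by positivity)]
    linarith
  have := P.le this hu
  rw [inner_smul_right, real_inner_self_eq_norm_sq, P.unit u hu] at this
  linarith

lemma PolyH.fin {U K h} (P : PolyH U K h) : volume K ≠ ⊤ := P.cpt.measure_lt_top.ne

lemma PolyH.vpos {U K h} (P : PolyH U K h) : 0 < volume.real K := by
  have : 0 < volume K := Measure.measure_pos_of_mem_nhds _ (mem_interior_iff_mem_nhds.1 P.zero)
  exact ENNReal.toReal_pos this.ne' P.fin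

lemma face_compact {U K h} (P : PolyH U K h) (u : E3) : IsCompact (face K h u) := by
  refine P.cpt.inter_right (t := {x | inner ℝ u x = h u}) ?_
  exact isClosed_eq (f := fun x : E3 => inner ℝ u x) (g := fun _ => h u) (by fun_prop) (by fun_prop)

open Pointwise Topology Filter in
lemma slab' {U K h} (P : PolyH U K h) {u} (hu : u ∈ U) (e : ℝ) (he : 0 < e) :
    ∀ᶠ t in 𝓝[>] (0 : ℝ), ∀ k : ℝ, 0 ≤ k →
      volume.real {x | x ∈ (1 + t) • K ∧ h u < inner ℝ u x ∧ inner ℝ u x ≤ h u + k} ≤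
        k * (ar u (face K h u) + e) := by
  have hu1 := P.unit u hu
  obtain ⟨c0, c1, hc⟩ := cc_spec u hu1
  have hf : μH[2] (face K h u) ≠ ⊤ :=
    slice_finite u hu1 (h u) _ (fun x hx => hx.2) (face_compact P u)
  have hcf : cc u * μH[2] (face K h u) ≠ ⊤ := ENNReal.mul_ne_top c1 hf
  have ha : 0 ≤ ar u (face K h u) := ENNReal.toReal_nonneg
  have hlt : μH[2] (face K h u) < ENNReal.ofReal (ar u (face K h u) + e) / cc u := by
    rw [ENNReal.lt_div_iff_mul_lt (Or.inl c0) (Or.inl c1), mul_comm, ← ENNReal.ofReal_toReal hcf]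
    exact (ENNReal.ofReal_lt_ofReal_iff (by positivity)).2 (by unfold ar; linarith)
  obtain ⟨t0, ht0, H⟩ := slab_ub u hu1 (cc u) hc K P.cpt (h u) (fun x hx => P.le hx hu) _ hlt
  filter_upwards [Ioo_mem_nhdsGT ht0] with t ht k hk
  have := H t ht.1 ht.2 k
  rw [ENNReal.mul_div_cancel c0 c1, ← ENNReal.ofReal_mul hk] at this
  exact ENNReal.toReal_le_of_le_ofReal (by positivity) this

lemma vol_smul (r : ℝ) (hr : 0 ≤ r) (K : Set E3) : volume.real ((fun x => r • x) '' K) = r ^ 3 * volume.real K := by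
  have := Measure.addHaar_image_homothety (volume : Measure E3) 0 r K
  have e : (fun x : E3 => r • x) '' K = AffineMap.homothety (0:E3) r '' K := by
    apply Set.image_congr; intro x _; simp [AffineMap.homothety_apply]
  rw [e, measureReal_def, this, ENNReal.toReal_mul, ENNReal.toReal_ofReal (abs_nonneg _)]
  simp [abs_of_nonneg hr, measureReal_def]

open Pointwise Topology Filter in
lemma claimA {U K h} (P : PolyH U K h) (N : Set E3) (hN : IsCompact N)
    (hV : volume.real N = volume.real K) (k : E3 → ℝ) (hk : ∀ u ∈ U, 0 ≤ k u)
    (hNk : ∀ x ∈ N, ∀ u ∈ U, inner ℝ u x ≤ k u) :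
    3 * volume.real K ≤ ∑ u ∈ U, k u * ar u (face K h u) := by
  have key : ∀ e > 0, 3 * volume.real K ≤ ∑ u ∈ U, k u * (ar u (face K h u) + e) := by
    intro e he
    set C : ℝ := ∑ u ∈ U, k u / h u + 1 with hC
    have hsn : ∀ u ∈ U, 0 ≤ k u / h u := fun u hu => div_nonneg (hk u hu) (P.pos hu).le
    have hC0 : 0 < C := by have := Finset.sum_nonneg hsn; linarith
    have hCk : ∀ u ∈ U, k u ≤ C * h u := by
      intro u hu
      have := Finset.single_le_sum hsn hu
      have h2 : k u / h u ≤ C := by linarith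
      rwa [div_le_iff₀ (P.pos hu)] at h2
    have T : Tendsto (fun t : ℝ => C * t) (𝓝[>] 0) (𝓝[>] 0) := by
      rw [tendsto_nhdsWithin_iff]
      constructor
      · have : Tendsto (fun t : ℝ => C * t) (𝓝 0) (𝓝 (C * 0)) := by
          apply Continuous.tendsto; fun_prop
        rw [mul_zero] at this
        exact this.mono_left nhdsWithin_le_nhds
      · filter_upwards [self_mem_nhdsWithin] with t ht
        exact mul_pos hC0 ht
    have ev : ∀ᶠ t in 𝓝[>] (0 : ℝ), ∀ u ∈ U, ∀ k : ℝ, 0 ≤ k →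
      volume.real {x | x ∈ (1 + C * t) • K ∧ h u < inner ℝ u x ∧ inner ℝ u x ≤ h u + k} ≤
        k * (ar u (face K h u) + e) := by
      rw [Filter.eventually_all_finset]
      intro u hu
      exact T.eventually (slab' P hu e he)
    obtain ⟨t, ht, ht0⟩ := (ev.and self_mem_nhdsWithin).exists
    have ht0 : 0 < t := ht0
    set Q : Set E3 := {x | ∀ u ∈ U, inner ℝ u x ≤ h u + t * k u} with hQ
    have hQK : Q ⊆ (1 + C * t) • K := by
      intro x hx
      have hp : 0 < 1 + C * t := by positivity
      rw [Set.mem_smul_set_iff_inv_smul_mem₀ hp.ne']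
      refine P.mem fun u hu => ?_
      rw [inner_smul_right, inv_mul_le_iff₀ hp]
      have := hx u hu
      have := hCk u hu
      nlinarith
    have hQc : IsClosed Q := by
      have : Q = ⋂ u ∈ U, {x : E3 | inner ℝ u x ≤ h u + t * k u} := by
        ext x; simp [hQ]
      rw [this]
      refine isClosed_biInter fun u _ => ?_
      exact isClosed_le (f := fun x : E3 => inner ℝ u x) (g := fun _ => h u + t * k u)
        (by fun_prop) (by fun_prop)
    have hQcpt : IsCompact Q := (P.cpt.smul (1 + C * t)).of_isClosed_subset hQc hQK
    have ht1 : 0 < 1 + t := by positivity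
    have bm := bm_set (t / (1 + t)) (by positivity) (by rw [div_lt_one ht1]; linarith)
      ((fun x => (1 + t) • x) '' K) ((fun x => (1 + t) • x) '' N) Q
      (P.cpt.image (by fun_prop)).measurableSet (hN.image (by fun_prop)).measurableSet
      hQc.measurableSet hQcpt.measure_lt_top.ne ?_
    swap
    · rintro _ ⟨x, hx, rfl⟩ _ ⟨y, hy, rfl⟩
      have e1 : (1 - t / (1 + t)) • (1 + t) • x + (t / (1 + t)) • (1 + t) • y = x + t • y := by
        rw [smul_smul, smul_smul]
        congr 1
        · have : (1 - t / (1 + t)) * (1 + t) = 1 := by field_simp; ring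
          rw [this, one_smul]
        · congr 1; field_simp
      show (1 - t / (1 + t)) • (1 + t) • x + (t / (1 + t)) • (1 + t) • y ∈ Q
      rw [e1]
      intro u hu
      rw [inner_add_right, inner_smul_right]
      have := P.le hx hu
      have := hNk y hy u hu
      nlinarith
    rw [vol_smul _ ht1.le, vol_smul _ ht1.le, hV, ← Real.rpow_add (by have := P.vpos; positivity),
      sub_add_cancel, Real.rpow_one] at bm
    have hsub : Q ⊆ K ∪ ⋃ u ∈ U, {x | x ∈ (1 + C * t) • K ∧ h u < inner ℝ u x ∧ inner ℝ u x ≤ h u + t * k u} := by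
      intro x hx
      by_cases hxK : x ∈ K
      · exact Or.inl hxK
      · right
        have : ¬ ∀ u ∈ U, inner ℝ u x ≤ h u := fun h' => hxK (P.mem h')
        push Not at this
        obtain ⟨u, hu, hlt⟩ := this
        simp only [Set.mem_iUnion]
        exact ⟨u, hu, hQK hx, hlt, hx u hu⟩
    have hfin : volume (K ∪ ⋃ u ∈ U, {x | x ∈ (1 + C * t) • K ∧ h u < inner ℝ u x ∧ inner ℝ u x ≤ h u + t * k u}) ≠ ⊤ := by
      refine (lt_of_le_of_lt (measure_mono (t := K ∪ (1 + C * t) • K) ?_)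
        (P.cpt.union (P.cpt.smul (1 + C * t))).measure_lt_top).ne
      apply Set.union_subset_union_right
      intro x hx
      simp only [Set.mem_iUnion] at hx
      obtain ⟨u, hu, hx⟩ := hx
      exact hx.1
    have h1 := measureReal_mono hsub hfin
    have h2 := measureReal_union_le (μ := volume) K (⋃ u ∈ U, {x | x ∈ (1 + C * t) • K ∧ h u < inner ℝ u x ∧ inner ℝ u x ≤ h u + t * k u})
    have h3 := measureReal_biUnion_finset_le (μ := volume) U (fun u => {x | x ∈ (1 + C * t) • K ∧ h u < inner ℝ u x ∧ inner ℝ u x ≤ h u + t * k u})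
    have h4 := Finset.sum_le_sum (fun u hu => ht u hu (t * k u) (mul_nonneg ht0.le (hk u hu)))
    simp only [mul_assoc] at h4
    rw [← Finset.mul_sum] at h4
    have h5 : (1 + t) ^ 3 * volume.real K ≤ volume.real K + t * ∑ u ∈ U, k u * (ar u (face K h u) + e) := by
      linarith
    have h6 : t * (3 * volume.real K) ≤ t * ∑ u ∈ U, k u * (ar u (face K h u) + e) := by
      have : 0 ≤ (3 * t ^ 2 + t ^ 3) * volume.real K := by have := P.vpos; positivity
      nlinarith
    exact le_of_mul_le_mul_left h6 ht0
  have lim : Tendsto (fun e : ℝ => ∑ u ∈ U, k u * (ar u (face K h u) + e)) (𝓝[>] 0)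
      (𝓝 (∑ u ∈ U, k u * (ar u (face K h u) + 0))) := by
    refine Tendsto.mono_left ?_ nhdsWithin_le_nhds
    apply Continuous.tendsto (f := fun e : ℝ => ∑ u ∈ U, k u * (ar u (face K h u) + e))
    fun_prop
  simp only [add_zero] at lim
  refine ge_of_tendsto lim ?_
  filter_upwards [self_mem_nhdsWithin] with e he using key e he

lemma null_hyper (w : E3) (hw : w ≠ 0) (s : ℝ) : volume {x : E3 | inner ℝ w x = s} = 0 := by
  let A : AffineSubspace ℝ E3 := AffineSubspace.comap (innerSL ℝ w).toLinearMap.toAffineMap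
    (AffineSubspace.mk' s ⊥)
  have hA : {x : E3 | inner ℝ w x = s} = (A : Set E3) := by
    ext x
    simp [A, AffineSubspace.mem_mk', sub_eq_zero]
  rw [hA]
  apply Measure.addHaar_affineSubspace
  intro htop
  have h1 : ∀ x : E3, inner ℝ w x = s := by
    intro x
    have : x ∈ (A : Set E3) := by rw [htop]; trivial
    rw [← hA] at this
    exact this
  have h2 := h1 0
  have h3 := h1 w
  rw [inner_zero_right] at h2
  rw [← h2] at h3
  exact hw (inner_self_eq_zero.1 h3)

lemma claimB {U K h} (P : PolyH U K h) :
    ∑ u ∈ U, h u * ar u (face K h u) ≤ 3 * volume.real K := by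
  set Cn : E3 → Set E3 := fun u =>
    {x : E3 | 0 < inner ℝ u x ∧ inner ℝ u x ≤ h u ∧ (h u / inner ℝ u x) • x ∈ face K h u} with hCn
  have hv : ∀ u ∈ U, MeasurableSet (Cn u) ∧ volume (Cn u) = ENNReal.ofReal (h u / 3) * (cc u * μH[2] (face K h u)) :=
    fun u hu => cone_vol u (P.unit u hu) (cc u) (cc_spec u (P.unit u hu)).2.2 _ (face_compact P u).isClosed (h u)
      (P.pos hu) (fun x hx => hx.2)
  have hsub : (⋃ u ∈ U, Cn u) ⊆ K := by
    intro x hx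
    simp only [Set.mem_iUnion] at hx
    obtain ⟨u, hu, h0, hle, hx⟩ := hx
    have hp := P.pos hu
    have := P.conv.smul_mem_of_zero_mem (interior_subset P.zero) hx.1
      (t := inner ℝ u x / h u) ⟨by positivity, by rw [div_le_one hp]; exact hle⟩
    rw [smul_smul] at this
    have e : inner ℝ u x / h u * (h u / inner ℝ u x) = 1 := by field_simp
    rwa [e, one_smul] at this
  have hdis : Set.Pairwise (↑U) (Function.onFun (AEDisjoint volume) Cn) := by
    intro u hu u' hu' hne
    have hp := P.pos hu
    have hp' := P.pos hu'
    have hw : (h u)⁻¹ • u - (h u')⁻¹ • u' ≠ 0 := by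
      intro h0
      have h1 := sub_eq_zero.1 h0
      have h2 := congrArg norm h1
      rw [norm_smul, norm_smul, P.unit u hu, P.unit u' hu', Real.norm_eq_abs, Real.norm_eq_abs,
        abs_of_pos (by positivity), abs_of_pos (by positivity), mul_one, mul_one] at h2
      rw [h2] at h1
      exact hne (smul_right_injective E3 (inv_ne_zero hp'.ne') h1)
    refine measure_mono_null ?_ (null_hyper _ hw 0)
    rintro x ⟨⟨a1, a2, a3⟩, ⟨b1, b2, b3⟩⟩
    have c1 := P.le a3.1 hu'
    have c2 := P.le b3.1 hu
    rw [inner_smul_right] at c1 c2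
    show inner ℝ ((h u)⁻¹ • u - (h u')⁻¹ • u') x = 0
    rw [inner_sub_left, real_inner_smul_left, real_inner_smul_left]
    rw [div_mul_eq_mul_div, div_le_iff₀ a1] at c1
    rw [div_mul_eq_mul_div, div_le_iff₀ b1] at c2
    field_simp
    linarith
  have := measure_biUnion_finset₀ hdis (fun u hu => (hv u hu).1.nullMeasurableSet)
  have h2 : ∑ u ∈ U, volume (Cn u) ≤ volume K := by rw [← this]; exact measure_mono hsub
  have h3 := ENNReal.toReal_mono P.fin h2
  rw [ENNReal.toReal_sum] at h3
  · have h4 : ∑ u ∈ U, (volume (Cn u)).toReal = ∑ u ∈ U, h u * ar u (face K h u) / 3 := by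
      refine Finset.sum_congr rfl fun u hu => ?_
      rw [(hv u hu).2, ENNReal.toReal_mul, ENNReal.toReal_ofReal (by have := P.pos hu; positivity), ar]
      ring
    rw [h4, ← Finset.sum_div] at h3
    rw [measureReal_def]
    linarith
  · intro u hu
    exact ne_top_of_le_ne_top P.fin (measure_mono ((Set.subset_biUnion_of_mem hu).trans hsub))

lemma claimC {U K h} (P : PolyH U K h) (N : Set E3) (hN : IsCompact N)
    (hV : 0 < volume.real N) (k : E3 → ℝ) (hk : ∀ u ∈ U, 0 ≤ k u)
    (hNk : ∀ x ∈ N, ∀ u ∈ U, inner ℝ u x ≤ k u) :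
    ∃ r : ℝ, 0 < r ∧ r ^ 3 * volume.real N = volume.real K ∧
    3 * volume.real K ≤ r * ∑ u ∈ U, k u * ar u (face K h u) := by
  have hp := P.vpos
  set r : ℝ := (volume.real K / volume.real N) ^ (1 / 3 : ℝ) with hr
  have hr0 : 0 < r := by positivity
  have hr3 : r ^ 3 * volume.real N = volume.real K := by
    rw [hr, ← Real.rpow_natCast, ← Real.rpow_mul (by positivity)]
    norm_num
    field_simp
  refine ⟨r, hr0, hr3, ?_⟩
  have := claimA P ((fun x => r • x) '' N) (hN.image (by fun_prop)) (by rw [vol_smul r hr0.le, hr3])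
    (fun u => r * k u) (fun u hu => mul_nonneg hr0.le (hk u hu)) ?_
  · rw [Finset.mul_sum]
    simpa only [mul_assoc] using this
  · rintro _ ⟨x, hx, rfl⟩ u hu
    rw [inner_smul_right]
    exact mul_le_mul_of_nonneg_left (hNk x hx u hu) hr0.le

lemma vol_le {U K L h g} (P : PolyH U K h) (Q : PolyH U L g)
    (ha : ∀ u ∈ U, ar u (face K h u) = ar u (face L g u)) : volume.real K ≤ volume.real L := by
  obtain ⟨r, hr, h3, hle⟩ := claimC P L Q.cpt Q.vpos g (fun u hu => (Q.pos hu).le)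
    (fun x hx u hu => Q.le hx hu)
  have e : ∑ u ∈ U, g u * ar u (face K h u) = ∑ u ∈ U, g u * ar u (face L g u) :=
    Finset.sum_congr rfl fun u hu => by rw [ha u hu]
  rw [e] at hle
  have hB := claimB Q
  have h4 : volume.real K ≤ r * volume.real L := by nlinarith
  have hL := Q.vpos
  have h5 : r ^ 3 ≤ r := by
    rw [← h3] at h4
    exact le_of_mul_le_mul_right h4 hL
  have h6 : r ≤ 1 := by
    by_contra hc
    push Not at hc
    nlinarith [mul_pos hr (sub_pos.2 hc), mul_pos hr hr]
  nlinarith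

def midS (K L : Set E3) : Set E3 := (fun p : E3 × E3 => (1 - (1 / 2 : ℝ)) • p.1 + (1 / 2 : ℝ) • p.2) '' (K ×ˢ L)

lemma midS_compact {K L : Set E3} (hK : IsCompact K) (hL : IsCompact L) : IsCompact (midS K L) :=
  (hK.prod hL).image (by fun_prop)

lemma mid_vol {U K L h g} (P : PolyH U K h) (Q : PolyH U L g)
    (ha : ∀ u ∈ U, ar u (face K h u) = ar u (face L g u)) :
    volume.real L = volume.real K ∧ volume.real (midS K L) = volume.real K := by
  have hV : volume.real L = volume.real K :=
    le_antisymm (vol_le Q P fun u hu => (ha u hu).symm) (vol_le P Q ha)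
  refine ⟨hV, ?_⟩
  have hp := P.vpos
  have hM := midS_compact P.cpt Q.cpt
  have h1 : volume.real K ≤ volume.real (midS K L) := by
    have := bm_set (1 / 2) (by norm_num) (by norm_num) K L (midS K L) P.cpt.measurableSet
      Q.cpt.measurableSet hM.measurableSet hM.measure_lt_top.ne
      (fun x hx y hy => ⟨(x, y), ⟨hx, hy⟩, rfl⟩)
    rw [hV, ← Real.rpow_add hp, sub_add_cancel, Real.rpow_one] at this
    exact this
  refine le_antisymm ?_ h1
  obtain ⟨r, hr, h3, hle⟩ := claimC P (midS K L) hM (by linarith) (fun u => (h u + g u) / 2)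
    (fun u hu => by have := P.pos hu; have := Q.pos hu; positivity) (by
      rintro _ ⟨⟨x, y⟩, ⟨hx, hy⟩, rfl⟩ u hu
      have := P.le hx hu
      have := Q.le hy hu
      simp only [inner_add_right, inner_smul_right]
      linarith)
  have hB := claimB P
  have hB' := claimB Q
  have e : ∑ u ∈ U, (h u + g u) / 2 * ar u (face K h u) = (∑ u ∈ U, h u * ar u (face K h u)
      + ∑ u ∈ U, g u * ar u (face L g u)) / 2 := by
    rw [← Finset.sum_add_distrib, Finset.sum_div]
    refine Finset.sum_congr rfl fun u hu => ?_
    rw [← ha u hu]; ring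
  rw [e] at hle
  have h4 : volume.real K ≤ r * volume.real K := by
    rw [hV] at hB'
    nlinarith
  have h5 : 1 ≤ r := by
    have : 1 * volume.real K ≤ r * volume.real K := by linarith
    exact le_of_mul_le_mul_right this hp
  have h6 : 1 ≤ r ^ 3 := one_le_pow₀ h5
  nlinarith [measureReal_nonneg (μ := volume) (s := midS K L)]

def lo (K : Set E3) (u : E3) (s : ℝ) : Set E3 := K ∩ {x | inner ℝ u x ≤ s}
def hi (K : Set E3) (u : E3) (s : ℝ) : Set E3 := K ∩ {x | s < inner ℝ u x}

lemma lo_meas {K : Set E3} (hK : MeasurableSet K) (u s) : MeasurableSet (lo K u s) :=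
  hK.inter (measurableSet_le (f := fun x : E3 => inner ℝ u x) (g := fun _ => s) (by fun_prop) (by fun_prop))
lemma hi_meas {K : Set E3} (hK : MeasurableSet K) (u s) : MeasurableSet (hi K u s) :=
  hK.inter (measurableSet_lt (g := fun x : E3 => inner ℝ u x) (f := fun _ => s) (by fun_prop) (by fun_prop))

lemma lo_hi {K : Set E3} (hK : IsCompact K) (u s) :
    volume.real (hi K u s) = volume.real K - volume.real (lo K u s) := by
  have h1 : K = lo K u s ∪ hi K u s := by
    ext x
    constructor
    · intro hx
      rcases le_or_gt (inner ℝ u x) s with h | h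
      · exact Or.inl ⟨hx, h⟩
      · exact Or.inr ⟨hx, h⟩
    · rintro (h | h)
      · exact h.1
      · exact h.1
  have hd : Disjoint (lo K u s) (hi K u s) := by
    rw [Set.disjoint_left]
    rintro x ⟨_, h1⟩ ⟨_, h2⟩
    exact (not_lt.2 (show inner ℝ u x ≤ s from h1)) h2
  have := measureReal_union (μ := volume) hd (hi_meas hK.measurableSet u s)
    (measure_ne_top_of_subset Set.inter_subset_left hK.measure_lt_top.ne)
    (measure_ne_top_of_subset Set.inter_subset_left hK.measure_lt_top.ne)
  rw [← h1] at this
  linarith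

open Topology Filter in
lemma lo_cont {K : Set E3} (hK : IsCompact K) (u : E3) (hu : u ≠ 0) :
    Continuous (fun s => volume.real (lo K u s)) := by
  have e : (fun s => volume.real (lo K u s)) =
      fun s => ∫ x in K, ({x : E3 | inner ℝ u x ≤ s}.indicator (fun _ => (1:ℝ)) x) := by
    ext s
    have hm : MeasurableSet {x : E3 | inner ℝ u x ≤ s} :=
      measurableSet_le (f := fun x : E3 => inner ℝ u x) (g := fun _ => s) (by fun_prop) (by fun_prop)
    rw [integral_indicator_const _ hm, measureReal_restrict_apply hm]
    simp [lo, Set.inter_comm]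
  rw [e, continuous_iff_continuousAt]
  intro s0
  have : IsFiniteMeasure (volume.restrict K) := ⟨by simpa using hK.measure_lt_top⟩
  refine continuousAt_of_dominated (bound := fun _ => 1) ?_ ?_ (integrable_const _) ?_
  · refine Eventually.of_forall fun s => ?_
    have hm : MeasurableSet {x : E3 | inner ℝ u x ≤ s} :=
      measurableSet_le (f := fun x : E3 => inner ℝ u x) (g := fun _ => s) (by fun_prop) (by fun_prop)
    exact (measurable_const.indicator hm).aestronglyMeasurable
  · refine Eventually.of_forall fun s => Eventually.of_forall fun x => ?_
    refine (norm_indicator_le_norm_self _ _).trans ?_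
    simp
  · have hn : ∀ᵐ x ∂(volume.restrict K), inner ℝ u x ≠ s0 := by
      apply ae_restrict_of_ae
      rw [ae_iff]
      have := null_hyper u hu s0
      simpa using this
    filter_upwards [hn] with x hx
    rcases lt_or_gt_of_ne hx with h | h
    · have : (fun s => ({x : E3 | inner ℝ u x ≤ s}.indicator (fun _ => (1:ℝ)) x)) =ᶠ[𝓝 s0] fun _ => 1 := by
        filter_upwards [lt_mem_nhds h] with s hs
        exact Set.indicator_of_mem (s := {x : E3 | inner ℝ u x ≤ s}) hs.le _
      exact continuousAt_const.congr this.symm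
    · have : (fun s => ({x : E3 | inner ℝ u x ≤ s}.indicator (fun _ => (1:ℝ)) x)) =ᶠ[𝓝 s0] fun _ => 0 := by
        filter_upwards [gt_mem_nhds h] with s hs
        exact Set.indicator_of_notMem (s := {x : E3 | inner ℝ u x ≤ s}) (not_le.2 hs) _
      exact continuousAt_const.congr this.symm

lemma lo_bm (l : ℝ) (h0 : 0 < l) (h1 : l < 1) {A B C : Set E3} (hA : IsCompact A) (hB : IsCompact B)
    (hC : IsCompact C) (H : ∀ x ∈ A, ∀ y ∈ B, (1 - l) • x + l • y ∈ C) (u : E3) (s t : ℝ) :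
    volume.real (lo A u s) ^ (1 - l) * volume.real (lo B u t) ^ l ≤
      volume.real (lo C u ((1 - l) * s + l * t)) := by
  refine bm_set l h0 h1 _ _ _ (lo_meas hA.measurableSet u s) (lo_meas hB.measurableSet u t)
    (lo_meas hC.measurableSet u _)
    (measure_ne_top_of_subset Set.inter_subset_left hC.measure_lt_top.ne) ?_
  rintro x ⟨hx, hx2⟩ y ⟨hy, hy2⟩
  refine ⟨H x hx y hy, ?_⟩
  rw [Set.mem_ofPred_eq] at *
  rw [inner_add_right, inner_smul_right, inner_smul_right]
  nlinarith

lemma hi_bm (l : ℝ) (h0 : 0 < l) (h1 : l < 1) {A B C : Set E3} (hA : IsCompact A) (hB : IsCompact B)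
    (hC : IsCompact C) (H : ∀ x ∈ A, ∀ y ∈ B, (1 - l) • x + l • y ∈ C) (u : E3) (s t : ℝ) :
    volume.real (hi A u s) ^ (1 - l) * volume.real (hi B u t) ^ l ≤
      volume.real (hi C u ((1 - l) * s + l * t)) := by
  refine bm_set l h0 h1 _ _ _ (hi_meas hA.measurableSet u s) (hi_meas hB.measurableSet u t)
    (hi_meas hC.measurableSet u _)
    (measure_ne_top_of_subset Set.inter_subset_left hC.measure_lt_top.ne) ?_
  rintro x ⟨hx, hx2⟩ y ⟨hy, hy2⟩
  refine ⟨H x hx y hy, ?_⟩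
  rw [Set.mem_ofPred_eq] at *
  rw [inner_add_right, inner_smul_right, inner_smul_right]
  have h1' : 0 < 1 - l := by linarith
  exact add_lt_add (mul_lt_mul_of_pos_left hx2 h1') (mul_lt_mul_of_pos_left hy2 h0)

def cdfK (K : Set E3) (u : E3) (s : ℝ) : ℝ := volume.real (lo K u s) / volume.real K

lemma one_sub_cdfK {K : Set E3} (hK : IsCompact K) (hV : 0 < volume.real K) (u s) :
    1 - cdfK K u s = volume.real (hi K u s) / volume.real K := by
  rw [lo_hi hK, cdfK]; field_simp

lemma div_bm {a b c V l : ℝ} (ha : 0 ≤ a) (hb : 0 ≤ b) (hV : 0 < V)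
    (h : a ^ (1 - l) * b ^ l ≤ c) : (a / V) ^ (1 - l) * (b / V) ^ l ≤ c / V := by
  rw [Real.div_rpow ha hV.le, Real.div_rpow hb hV.le, div_mul_div_comm, ← Real.rpow_add hV,
    sub_add_cancel, Real.rpow_one]
  gcongr

lemma cdf_LC {K : Set E3} (hK : IsCompact K) (hc : Convex ℝ K) (hV : 0 < volume.real K) (u : E3)
    (hu : u ≠ 0) : LC (cdfK K u) := by
  have hfin : ∀ s, volume (lo K u s) ≠ ⊤ := fun s =>
    measure_ne_top_of_subset Set.inter_subset_left hK.measure_lt_top.ne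
  have hb := hK.exists_bound_of_continuousOn (f := fun x : E3 => inner ℝ u x) (by fun_prop)
  obtain ⟨C, hC⟩ := hb
  refine ⟨?_, ?_, ?_, ?_, ⟨-C - 1, ?_⟩, ⟨C, ?_⟩, ?_, ?_⟩
  · exact (lo_cont hK u hu).div_const _
  · intro s t hst
    unfold cdfK
    gcongr
    · exact hfin t
    · exact fun x hx => ⟨hx.1, le_trans hx.2 hst⟩
  · intro s; unfold cdfK; positivity
  · intro s; unfold cdfK
    rw [div_le_one hV]
    exact measureReal_mono Set.inter_subset_left hK.measure_lt_top.ne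
  · have : lo K u (-C - 1) = ∅ := by
      rw [Set.eq_empty_iff_forall_notMem]
      rintro x ⟨hx, hx2⟩
      have h1 := (abs_le.1 (hC x hx)).1
      rw [Set.mem_ofPred_eq] at hx2
      linarith
    simp [cdfK, this]
  · have : lo K u C = K := by
      refine Set.inter_eq_left.2 fun x hx => ?_
      exact (abs_le.1 (hC x hx)).2
    rw [cdfK, this, div_self hV.ne']
  · intro l h0 h1 x y
    exact div_bm (by positivity) (by positivity) hV (lo_bm l h0 h1 hK hK hK
      (fun x hx y hy => hc hx hy (by linarith) h0.le (by ring)) u x y)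
  · intro l h0 h1 x y
    rw [one_sub_cdfK hK hV, one_sub_cdfK hK hV, one_sub_cdfK hK hV]
    exact div_bm (by positivity) (by positivity) hV (hi_bm l h0 h1 hK hK hK
      (fun x hx y hy => hc hx hy (by linarith) h0.le (by ring)) u x y)

lemma sqrt_form {a b c : ℝ} (ha : 0 ≤ a) (hb : 0 ≤ b)
    (h : a ^ (1 - (1 / 2 : ℝ)) * b ^ (1 / 2 : ℝ) ≤ c) : a * b ≤ c ^ 2 := by
  have e : (1 - (1 / 2 : ℝ)) = 1 / 2 := by norm_num
  rw [e, ← Real.mul_rpow ha hb, ← Real.sqrt_eq_rpow] at h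
  exact (Real.sqrt_le_left (le_trans (Real.sqrt_nonneg _) h)).1 h

lemma shift_exists {U K L h g} (P : PolyH U K h) (Q : PolyH U L g)
    (ha : ∀ u ∈ U, ar u (face K h u) = ar u (face L g u)) (u : E3) (hu : u ≠ 0) :
    ∃ c, ∀ t, volume.real (lo K u (t + c)) = volume.real (lo L u t) := by
  obtain ⟨hL, hM⟩ := mid_vol P Q ha
  have hp := P.vpos
  have hMc := midS_compact P.cpt Q.cpt
  have hmem : ∀ x ∈ K, ∀ y ∈ L, (1 - (1 / 2 : ℝ)) • x + (1 / 2 : ℝ) • y ∈ midS K L :=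
    fun x hx y hy => ⟨(x, y), ⟨hx, hy⟩, rfl⟩
  obtain ⟨c, hc⟩ := oneD (cdfK K u) (cdfK L u) (cdfK (midS K L) u)
    (cdf_LC P.cpt P.conv hp u hu) (cdf_LC Q.cpt Q.conv Q.vpos u hu)
    (fun s => by unfold cdfK; positivity)
    (fun s => by
      unfold cdfK
      rw [div_le_one (by rw [hM]; exact hp)]
      exact measureReal_mono Set.inter_subset_left hMc.measure_lt_top.ne)
    (fun s t => by
      apply sqrt_form (by unfold cdfK; positivity) (by unfold cdfK; positivity)
      have := lo_bm (1 / 2) (by norm_num) (by norm_num) P.cpt Q.cpt hMc hmem u s t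
      have e : (1 - (1 / 2 : ℝ)) * s + 1 / 2 * t = (s + t) / 2 := by ring
      rw [e] at this
      unfold cdfK
      rw [hL, hM]
      exact div_bm (by positivity) (by positivity) hp this)
    (fun s t => by
      rw [one_sub_cdfK P.cpt hp, one_sub_cdfK Q.cpt Q.vpos, one_sub_cdfK hMc (by rw [hM]; exact hp)]
      apply sqrt_form (by positivity) (by positivity)
      have := hi_bm (1 / 2) (by norm_num) (by norm_num) P.cpt Q.cpt hMc hmem u s t
      have e : (1 - (1 / 2 : ℝ)) * s + 1 / 2 * t = (s + t) / 2 := by ring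
      rw [e] at this
      rw [hL, hM]
      exact div_bm (by positivity) (by positivity) hp this)
  refine ⟨c, fun t => ?_⟩
  have := hc t
  unfold cdfK at this
  rw [hL] at this
  field_simp at this
  exact this

lemma hi_pos {U K h} (P : PolyH U K h) (u : E3) (s : ℝ) (x : E3) (hx : x ∈ K) (hs : s < inner ℝ u x) :
    0 < volume.real (hi K u s) := by
  have hcl : x ∈ closure (interior K) := by
    rw [P.conv.closure_interior_eq_closure_of_nonempty_interior ⟨0, P.zero⟩]
    exact subset_closure hx
  have ho : IsOpen {x : E3 | s < inner ℝ u x} :=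
    isOpen_lt (f := fun _ : E3 => s) (g := fun x : E3 => inner ℝ u x) (by fun_prop) (by fun_prop)
  have hne : ({x : E3 | s < inner ℝ u x} ∩ interior K).Nonempty :=
    mem_closure_iff.1 hcl _ ho hs
  have hpos := (ho.inter isOpen_interior).measure_pos volume hne
  have hsub : {x : E3 | s < inner ℝ u x} ∩ interior K ⊆ hi K u s :=
    fun y hy => ⟨interior_subset hy.2, hy.1⟩
  exact ENNReal.toReal_pos (lt_of_lt_of_le hpos (measure_mono hsub)).ne'
    (measure_ne_top_of_subset Set.inter_subset_left P.fin)

lemma shift_val {K L : Set E3} (hK : IsCompact K) (hL : IsCompact L) (u : E3) (c : ℝ)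
    (hc : ∀ t, volume.real (lo K u (t + c)) = volume.real (lo L u t)) :
    inner ℝ u (∫ x in K, x) = inner ℝ u (∫ x in L, x) + c * volume.real L := by
  have f1 : IsFiniteMeasure (volume.restrict K) := ⟨by simpa using hK.measure_lt_top⟩
  have f2 : IsFiniteMeasure (volume.restrict L) := ⟨by simpa using hL.measure_lt_top⟩
  have m1 : Measurable (fun x : E3 => inner ℝ u x) := by fun_prop
  have m2 : Measurable (fun x : E3 => inner ℝ u x + c) := by fun_prop
  have e : (volume.restrict K).map (fun x : E3 => inner ℝ u x) =
      (volume.restrict L).map (fun x : E3 => inner ℝ u x + c) := by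
    have := Measure.isFiniteMeasure_map (volume.restrict K) (fun x : E3 => inner ℝ u x)
    refine Measure.ext_of_Iic _ _ fun s => ?_
    rw [Measure.map_apply m1 measurableSet_Iic, Measure.map_apply m2 measurableSet_Iic,
      Measure.restrict_apply (m1 measurableSet_Iic), Measure.restrict_apply (m2 measurableSet_Iic)]
    have h1 : (fun x : E3 => inner ℝ u x) ⁻¹' Set.Iic s ∩ K = lo K u (s - c + c) := by
      rw [sub_add_cancel]; exact Set.inter_comm _ _
    have h2 : (fun x : E3 => inner ℝ u x + c) ⁻¹' Set.Iic s ∩ L = lo L u (s - c) := by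
      rw [Set.inter_comm]
      ext x
      refine and_congr Iff.rfl ?_
      show inner ℝ u x + c ≤ s ↔ inner ℝ u x ≤ s - c
      exact le_sub_iff_add_le.symm
    rw [h1, h2]
    exact (ENNReal.toReal_eq_toReal_iff' (measure_ne_top_of_subset Set.inter_subset_left hK.measure_lt_top.ne)
      (measure_ne_top_of_subset Set.inter_subset_left hL.measure_lt_top.ne)).1 (hc (s - c))
  have i1 : Integrable (fun x : E3 => x) (volume.restrict K) :=
    (continuous_id.continuousOn (s := K)).integrableOn_compact hK
  have i2 : Integrable (fun x : E3 => x) (volume.restrict L) :=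
    (continuous_id.continuousOn (s := L)).integrableOn_compact hL
  have h3 : ∫ y, y ∂((volume.restrict K).map (fun x : E3 => inner ℝ u x)) =
    ∫ y, y ∂((volume.restrict L).map (fun x : E3 => inner ℝ u x + c)) := by rw [e]
  rw [integral_map m1.aemeasurable (by fun_prop), integral_map m2.aemeasurable (by fun_prop),
    integral_add (i2.const_inner u) (integrable_const c), integral_inner i1, integral_inner i2] at h3
  rw [h3]
  simp [mul_comm]

lemma core {U K L h g} (P : PolyH U K h) (Q : PolyH U L g)
    (ha : ∀ u ∈ U, ar u (face K h u) = ar u (face L g u)) :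
    ∃ t : E3, L = (fun x => x + t) '' K := by
  obtain ⟨hV, -⟩ := mid_vol P Q ha
  have hp := P.vpos
  set d : E3 := (volume.real K)⁻¹ • ((∫ x in K, x) - ∫ x in L, x) with hd
  have key : ∀ u ∈ U, ∀ t, volume.real (lo K u (t + inner ℝ u d)) = volume.real (lo L u t) := by
    intro u hu
    obtain ⟨c, hc⟩ := shift_exists P Q ha u (by
      intro h0; have := P.unit u hu; simp [h0] at this)
    have h1 := shift_val P.cpt Q.cpt u c hc
    have : inner ℝ u d = c := by
      rw [hd, inner_smul_right, inner_sub_right, h1, hV]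
      field_simp
      ring
    rw [this]; exact hc
  have hK : ∀ u ∈ U, lo K u (h u) = K := fun u hu =>
    Set.inter_eq_left.2 fun x hx => P.le hx hu
  have hL : ∀ u ∈ U, lo L u (g u) = L := fun u hu =>
    Set.inter_eq_left.2 fun x hx => Q.le hx hu
  refine ⟨-d, ?_⟩
  ext y
  constructor
  · intro hy
    refine ⟨y + d, P.mem fun u hu => ?_, by simp⟩
    by_contra hcon
    push Not at hcon
    rw [inner_add_right] at hcon
    have h1 := hi_pos Q u (h u - inner ℝ u d) y hy (by linarith)
    rw [lo_hi Q.cpt, ← key u hu, sub_add_cancel, hK u hu, hV, sub_self] at h1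
    exact lt_irrefl _ h1
  · rintro ⟨x, hx, rfl⟩
    refine Q.mem fun u hu => ?_
    by_contra hcon
    push Not at hcon
    rw [inner_add_right, inner_neg_right] at hcon
    have h1 := hi_pos P u (g u + inner ℝ u d) x hx (by linarith)
    rw [lo_hi P.cpt, key u hu, hL u hu, hV, sub_self] at h1
    exact lt_irrefl _ h1

def Jv (v : E3) : E3 := !₂[v 0, - v 1, - v 2]

lemma mink_eq (x v : E3) : mink x v = inner ℝ (Jv v) x := by
  simp [mink, Jv, PiLp.inner_apply, Fin.sum_univ_three]
  ring

def nv (v : E3) : E3 := ‖Jv v‖⁻¹ • Jv v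

lemma Jv_pos (v : E3) (hv : mink v v = 1 ∨ mink v v = -1) : 0 < ‖Jv v‖ := by
  rw [norm_pos_iff]
  intro h
  rw [mink_eq, h, inner_zero_left] at hv
  norm_num at hv

lemma nv_inner (x v : E3) (hv : mink v v = 1 ∨ mink v v = -1) : mink x v = ‖Jv v‖ * inner ℝ (nv v) x := by
  have := Jv_pos v hv
  rw [mink_eq, nv, real_inner_smul_left]
  field_simp

lemma nv_norm (v : E3) (hv : mink v v = 1 ∨ mink v v = -1) : ‖nv v‖ = 1 := by
  have := Jv_pos v hv
  rw [nv, norm_smul, norm_inv, norm_norm]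
  field_simp

lemma reduce (n : ℕ) (v : Fin n → E3) (hv : ∀ f, mink (v f) (v f) = 1 ∨ mink (v f) (v f) = -1)
    (h : Fin n → ℝ) (P : Set E3) (hP : P = ⋂ f, {x | mink x (v f) ≤ h f}) (hc : IsCompact P)
    (x0 : E3) (hx0 : x0 ∈ interior P) (U : Finset E3) (hU : ∀ u, u ∈ U ↔ ∃ f, nv (v f) = u) :
    ∃ g : E3 → ℝ, PolyH U ((fun x => x + -x0) '' P) g ∧ ∀ f,
      ar (nv (v f)) (face ((fun x => x + -x0) '' P) g (nv (v f))) =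
        (cc (nv (v f))).toReal * (μH[2] (mface P (v f))).toReal := by
  set K : Set E3 := (fun x => x + -x0) '' P with hK
  have hKc : IsCompact K := hc.image (by fun_prop)
  have hx0P := interior_subset hx0
  have hKne : K.Nonempty := ⟨_, x0, hx0P, rfl⟩
  have hmax : ∀ u : E3, ∃ x ∈ K, ∀ y ∈ K, inner ℝ u y ≤ inner ℝ u x := fun u =>
    hKc.exists_isMaxOn hKne (f := fun x => inner ℝ u x) (by fun_prop)
  choose m hm hm2 using hmax
  refine ⟨fun u => inner ℝ u (m u), ⟨?_, hKc, ?_, ?_, fun u _ => ⟨m u, hm u, rfl⟩⟩, ?_⟩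
  · intro u hu
    obtain ⟨f, rfl⟩ := (hU u).1 hu
    exact nv_norm _ (hv f)
  · have := (Homeomorph.addRight (-x0)).image_interior P
    have h2 : (fun x => x + -x0) '' interior P = interior K := this
    rw [← h2]
    exact ⟨x0, hx0, by simp⟩
  · ext x
    refine ⟨fun hx u _ => hm2 u x hx, fun hx => ⟨x + x0, ?_, by simp⟩⟩
    rw [hP]
    simp only [Set.mem_iInter]
    intro f
    have h1 := hx (nv (v f)) ((hU _).2 ⟨f, rfl⟩)
    obtain ⟨y, hy, hy2⟩ := hm (nv (v f))
    have h2 : mink y (v f) ≤ h f := by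
      rw [hP] at hy
      exact Set.mem_iInter.1 hy f
    show mink (x + x0) (v f) ≤ h f
    rw [nv_inner _ _ (hv f)] at h2 ⊢
    rw [← hy2] at h1
    simp only [inner_add_right, inner_neg_right] at h1 ⊢
    refine le_trans ?_ h2
    exact mul_le_mul_of_nonneg_left (by linarith) (norm_nonneg _)
  · intro f
    have e : face K (fun u => inner ℝ u (m u)) (nv (v f)) = (fun x => x + -x0) '' mface P (v f) := by
      have hJ := Jv_pos (v f) (hv f)
      ext x
      constructor
      · rintro ⟨⟨p, hp, rfl⟩, hx⟩
        refine ⟨p, ⟨hp, fun y hy => ?_⟩, rfl⟩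
        have h1 := hm2 (nv (v f)) _ ⟨y, hy, rfl⟩
        simp only [] at hx
        rw [← hx] at h1
        simp only [inner_add_right, inner_neg_right] at h1
        rw [nv_inner _ _ (hv f), nv_inner _ _ (hv f)]
        exact mul_le_mul_of_nonneg_left (by linarith) (norm_nonneg _)
      · rintro ⟨p, ⟨hp, hp2⟩, rfl⟩
        refine ⟨⟨p, hp, rfl⟩, le_antisymm (hm2 _ _ ⟨p, hp, rfl⟩) ?_⟩
        obtain ⟨y, hy, hy2⟩ := hm (nv (v f))
        have h1 := hp2 y hy
        rw [nv_inner _ _ (hv f), nv_inner _ _ (hv f)] at h1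
        have h2 := le_of_mul_le_mul_left h1 hJ
        show inner ℝ (nv (v f)) (m (nv (v f))) ≤ inner ℝ (nv (v f)) (p + -x0)
        rw [← hy2]
        simp only [inner_add_right, inner_neg_right]
        linarith
    have hi : Isometry (fun x : E3 => x + -x0) := (IsometryEquiv.addRight (-x0)).isometry
    rw [ar, e, ENNReal.toReal_mul, hi.hausdorffMeasure_image (Or.inl (by norm_num))]

/-- two convex polyhedra in `ℝ^{2,1}` — bounded intersections of half-spaces
with non-null unit outward normals and nonempty interior — having the same set of pairs
(outward unit normal, face area) are translates of one another. -/
theorem lorentzian_polyhedra_same_normals_areas_translates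
    (n : ℕ) (v : Fin n → EuclideanSpace ℝ (Fin 3))
    (hv_unit : ∀ f, mink (v f) (v f) = 1 ∨ mink (v f) (v f) = -1)
    (h₁ h₂ : Fin n → ℝ) (P₁ P₂ : Set (EuclideanSpace ℝ (Fin 3)))
    (hP₁ : P₁ = ⋂ f, {x | mink x (v f) ≤ h₁ f}) (hc₁ : IsCompact P₁)
    (hi₁ : (interior P₁).Nonempty)
    (hP₂ : P₂ = ⋂ f, {x | mink x (v f) ≤ h₂ f}) (hc₂ : IsCompact P₂)
    (hi₂ : (interior P₂).Nonempty)
    (harea : ∀ f, minkArea (mface P₁ (v f)) (v f) = minkArea (mface P₂ (v f)) (v f)) :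
    ∃ t : EuclideanSpace ℝ (Fin 3), P₂ = (fun x => x + t) '' P₁ := by
  obtain ⟨x0, hx0⟩ := hi₁
  obtain ⟨y0, hy0⟩ := hi₂
  classical
  set U : Finset E3 := Finset.univ.image (fun f => nv (v f)) with hU
  have hU' : ∀ u, u ∈ U ↔ ∃ f, nv (v f) = u := by intro u; simp [hU]
  obtain ⟨g₁, p₁, a₁⟩ := reduce n v hv_unit h₁ P₁ hP₁ hc₁ x0 hx0 U hU'
  obtain ⟨g₂, p₂, a₂⟩ := reduce n v hv_unit h₂ P₂ hP₂ hc₂ y0 hy0 U hU'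
  obtain ⟨t, ht⟩ := core p₁ p₂ (by
    intro u hu
    obtain ⟨f, rfl⟩ := (hU' u).1 hu
    rw [a₁, a₂]
    have h := harea f
    have hv0 : ‖v f‖ ≠ 0 := by
      rw [norm_ne_zero_iff]
      intro h0
      have := hv_unit f
      simp [h0, mink] at this
    unfold minkArea at h
    rw [div_left_inj' hv0] at h
    rw [h])
  refine ⟨t + y0 - x0, ?_⟩
  ext y
  have h1 : y ∈ P₂ ↔ y + -y0 ∈ (fun x => x + -y0) '' P₂ :=
    ((add_left_injective (-y0)).mem_set_image (s := P₂) (a := y)).symm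
  rw [h1, ht]
  constructor
  · rintro ⟨_, ⟨x, hx, rfl⟩, hxy⟩
    refine ⟨x, hx, ?_⟩
    have hxy' : x + -x0 + t = y + -y0 := hxy
    have : y = x + -x0 + t + y0 := by rw [hxy']; abel
    rw [this]
    show x + (t + y0 - x0) = _
    abel
  · rintro ⟨x, hx, rfl⟩
    refine ⟨_, ⟨x, hx, rfl⟩, ?_⟩
    show x + -x0 + t = x + (t + y0 - x0) + -y0
    abel
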